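/- arXiv:1306.3674 — 5 statements merged into one kernel-verified Lean document; each statement's English description precedes it below -/
import Mathlib

section
/- There exist absolute constants C, c > 0 such that for every integer n≥2 and real 0<q<1, with π distributed according to the (n,q)-Mallows measure, the following two lower bounds hold: (a) if 1/2 ≤ q ≤ 1 − 4/n and L is an integer with C/√(1−q) ≤ L ≤ 1/(1−q), then P(LDS(π) ≥ L) ≥ 1 − (1 − (c/((1−q)L²))^L)^{⌊n(1−q)/4⌋}; (b) for every integer L ≥ 2, P(LDS(π) ≥ L) ≥ 1 − (1 − q^{L(L−1)/2}·(1−q)^L)^{⌊n/L⌋}. -/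
open Finset

/-- Number of inversions of a permutation of `Fin n`. -/
def mallowsInv {n : ℕ} (π : Equiv.Perm (Fin n)) : ℕ :=
  (Finset.univ.filter (fun p : Fin n × Fin n => p.1 < p.2 ∧ π p.2 < π p.1)).card

/-- The `(n,q)`-Mallows probability mass function on `S_n`. -/
noncomputable def mallowsPMF (n : ℕ) (q : ℝ) (π : Equiv.Perm (Fin n)) : ℝ :=
  q ^ mallowsInv π / ∑ σ : Equiv.Perm (Fin n), q ^ mallowsInv σ

/-- Probability of an event under the `(n,q)`-Mallows measure. -/
noncomputable def mallowsProb (n : ℕ) (q : ℝ) (A : Set (Equiv.Perm (Fin n))) : ℝ :=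
  ∑ π : Equiv.Perm (Fin n), A.indicator (mallowsPMF n q) π

/-- Expectation of a function under the `(n,q)`-Mallows measure. -/
noncomputable def mallowsExp (n : ℕ) (q : ℝ) (f : Equiv.Perm (Fin n) → ℝ) : ℝ :=
  ∑ π : Equiv.Perm (Fin n), mallowsPMF n q π * f π

/-- Length of the longest increasing subsequence of a permutation of `Fin n`. -/
noncomputable def LIS {n : ℕ} (π : Equiv.Perm (Fin n)) : ℕ :=
  sSup {m | ∃ f : Fin m → Fin n, StrictMono f ∧ StrictMono (fun j => π (f j))}

/-- Length of the longest decreasing subsequence of a permutation of `Fin n`. -/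
noncomputable def LDS {n : ℕ} (π : Equiv.Perm (Fin n)) : ℕ :=
  sSup {m | ∃ f : Fin m → Fin n, StrictMono f ∧ StrictAnti (fun j => π (f j))}

open MeasureTheory ProbabilityTheory

/-- The inversion code of a permutation: at `t`, the number of earlier entries which are larger
than the entry at `t`. -/
def inversionCode {n : ℕ} (π : Equiv.Perm (Fin n)) (t : Fin n) : Fin ((t : ℕ) + 1) :=
  ⟨#{i | i < t ∧ π t < π i}, by
    have h : #{i | i < t ∧ π t < π i} ≤ #(Finset.Iio t) :=
      card_le_card fun i hi => by simp at hi ⊢; exact hi.1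
    rw [Fin.card_Iio] at h
    omega⟩

theorem mallowsInv_eq_sum_inversionCode {n : ℕ} (π : Equiv.Perm (Fin n)) :
    mallowsInv π = ∑ t, (inversionCode π t : ℕ) := by
  simp only [mallowsInv, inversionCode, card_filter]
  rw [← univ_product_univ, sum_product_right]

/-- Permutations with the same inversion code have the same relative orders. -/
theorem lt_iff_lt_of_inversionCode_eq {n : ℕ} {π σ : Equiv.Perm (Fin n)}
    (h : inversionCode π = inversionCode σ) (m : ℕ) :
    ∀ i j : Fin n, (i : ℕ) < m → (j : ℕ) < m → (π i < π j ↔ σ i < σ j) := by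
  induction m with
  | zero => intro i j hi; omega
  | succ m ih =>
    have key : ∀ i t : Fin n, (t : ℕ) = m → i < t → (π t < π i ↔ σ t < σ i) := by
      intro i t ht hit
      subst ht
      have hcard : #{i | i < t ∧ π t < π i} = #{i | i < t ∧ σ t < σ i} := by
        have := congrArg Fin.val (congrFun h t)
        simpa [inversionCode] using this
      have hsub : ({i | i < t ∧ π t < π i} : Finset (Fin n)) ⊆ ({i | i < t ∧ σ t < σ i} : Finset _) ∨
          ({i | i < t ∧ σ t < σ i} : Finset (Fin n)) ⊆ ({i | i < t ∧ π t < π i} : Finset _) := by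
        by_contra! hcon
        obtain ⟨h1, h2⟩ := hcon
        obtain ⟨a, ha, ha'⟩ := not_subset.1 h1
        obtain ⟨b, hb, hb'⟩ := not_subset.1 h2
        simp only [mem_filter_univ, not_and, not_lt] at ha ha' hb hb'
        have hab := ih b a hb.1 ha.1
        have h3 : π b < π a := (hb' hb.1).trans_lt ha.2
        have h4 : σ a < σ b := (ha' ha.1).trans_lt hb.2
        exact absurd (hab.1 h3) h4.not_gt
      have heq : ({i | i < t ∧ π t < π i} : Finset (Fin n)) =
          ({i | i < t ∧ σ t < σ i} : Finset (Fin n)) := by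
        rcases hsub with hs | hs
        · exact eq_of_subset_of_card_le hs hcard.ge
        · exact (eq_of_subset_of_card_le hs hcard.le).symm
      have := congrArg (i ∈ ·) heq
      simpa [hit] using this
    intro i j hi hj
    rcases lt_trichotomy i j with hij | rfl | hij
    · by_cases hjm : (j : ℕ) = m
      · have := key i j hjm hij
        have h1 := π.injective.ne hij.ne
        have h2 := σ.injective.ne hij.ne
        grind
      · exact ih i j (by omega) (by omega)
    · simp
    · by_cases him : (i : ℕ) = m
      · exact key j i him hij
      · exact ih i j (by omega) (by omega)

theorem inversionCode_injective (n : ℕ) :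
    Function.Injective (inversionCode : Equiv.Perm (Fin n) → ∀ t : Fin n, Fin ((t : ℕ) + 1)) := by
  intro π σ h
  let e : Fin n ≃o Fin n := StrictMono.orderIsoOfSurjective (fun x => σ (π.symm x))
    (fun x y hxy => (lt_iff_lt_of_inversionCode_eq h n _ _ (Fin.isLt _) (Fin.isLt _)).1
      (by simpa using hxy)) (σ.surjective.comp π.symm.surjective)
  have he : e = OrderIso.refl _ := Subsingleton.elim _ _
  ext x
  have hx : σ (π.symm (π x)) = π x := congrArg (fun f : Fin n ≃o Fin n => f (π x)) he
  rw [← hx, Equiv.symm_apply_apply]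

theorem inversionCode_bijective (n : ℕ) :
    Function.Bijective (inversionCode : Equiv.Perm (Fin n) → ∀ t : Fin n, Fin ((t : ℕ) + 1)) := by
  rw [Fintype.bijective_iff_injective_and_card]
  refine ⟨inversionCode_injective n, ?_⟩
  rw [Fintype.card_perm, Fintype.card_pi]
  simp only [Fintype.card_fin]
  rw [Fin.prod_univ_eq_prod_range (fun t => t + 1), Finset.prod_range_add_one_eq_factorial]

theorem mallowsPMF_eq_prod {n : ℕ} (q : ℝ) (π : Equiv.Perm (Fin n)) :
    mallowsPMF n q π =
      ∏ t : Fin n, q ^ (inversionCode π t : ℕ) / ∑ j : Fin ((t : ℕ) + 1), q ^ (j : ℕ) := by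
  have hsum : ∑ σ : Equiv.Perm (Fin n), q ^ mallowsInv σ =
      ∏ t : Fin n, ∑ j : Fin ((t : ℕ) + 1), q ^ (j : ℕ) := by
    rw [prod_univ_sum, Fintype.piFinset_univ]
    refine (inversionCode_bijective n).sum_comp
      (fun c => ∏ t, q ^ (c t : ℕ)) |>.symm.trans ?_ |>.symm
    simp [mallowsInv_eq_sum_inversionCode, prod_pow_eq_pow_sum]
  rw [mallowsPMF, hsum, prod_div_distrib, prod_pow_eq_pow_sum, mallowsInv_eq_sum_inversionCode]

/-- An entry whose code exceeds an earlier code by at least the elapsed time is smaller. -/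
theorem apply_lt_apply_of_inversionCode {n : ℕ} (π : Equiv.Perm (Fin n)) {s t : Fin n}
    (hst : s < t) (h : (inversionCode π s : ℕ) + t ≤ inversionCode π t + s) : π t < π s := by
  by_contra! hle
  have hlt : π s < π t := lt_of_le_of_ne hle (π.injective.ne hst.ne)
  have hsub : ({i | i < t ∧ π t < π i} : Finset (Fin n)) ⊆
      ({i | i < s ∧ π s < π i} : Finset (Fin n)) ∪ Finset.Ioo s t := by
    intro i hi
    simp only [mem_filter_univ, mem_union, Finset.mem_Ioo] at hi ⊢
    rcases lt_trichotomy i s with his | rfl | his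
    · exact Or.inl ⟨his, hlt.trans hi.2⟩
    · exact absurd hi.2 hlt.not_gt
    · exact Or.inr ⟨his, hi.1⟩
  have hcard := (card_le_card hsub).trans (card_union_le _ _)
  rw [Fin.card_Ioo] at hcard
  have hs : (s : ℕ) < t := hst
  simp only [inversionCode] at h
  omega

theorem le_LDS {n L : ℕ} {π : Equiv.Perm (Fin n)} (f : Fin L → Fin n) (hf : StrictMono f)
    (hπ : StrictAnti fun j => π (f j)) : L ≤ LDS π := by
  refine le_csSup ⟨n, ?_⟩ ⟨f, hf, hπ⟩
  rintro m ⟨g, hg, -⟩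
  simpa using Fintype.card_le_of_injective g hg.injective

/-- The geometric distribution with parameter `q`, conditioned to be at most `t`. -/
noncomputable def truncGeom (q : ℝ) (t : ℕ) : Measure (Fin (t + 1)) :=
  ∑ j : Fin (t + 1),
    ENNReal.ofReal (q ^ (j : ℕ) / ∑ l : Fin (t + 1), q ^ (l : ℕ)) • Measure.dirac j

theorem sum_fin_pow_pos {q : ℝ} (hq : 0 < q) (t : ℕ) :
    0 < ∑ l : Fin (t + 1), q ^ (l : ℕ) :=
  sum_pos (fun _ _ => by positivity) univ_nonempty

theorem truncGeom_singleton (q : ℝ) (t : ℕ) (j : Fin (t + 1)) :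
    truncGeom q t {j} = ENNReal.ofReal (q ^ (j : ℕ) / ∑ l : Fin (t + 1), q ^ (l : ℕ)) := by
  simp only [truncGeom, Measure.coe_finsetSum, Measure.coe_smul, Finset.sum_apply, Pi.smul_apply,
    smul_eq_mul]
  rw [sum_eq_single j]
  · simp
  · intro i _ hij
    simp [hij]
  · simp

theorem isProbabilityMeasure_truncGeom {q : ℝ} (hq : 0 < q) (t : ℕ) :
    IsProbabilityMeasure (truncGeom q t) := by
  have hs := sum_fin_pow_pos hq t
  refine ⟨?_⟩
  rw [← coe_univ, ← sum_measure_singleton]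
  simp only [truncGeom_singleton]
  rw [← ENNReal.ofReal_sum_of_nonneg (fun _ _ => by positivity), ← sum_div, div_self hs.ne',
    ENNReal.ofReal_one]

theorem truncGeom_real_singleton {q : ℝ} (hq : 0 < q) (t : ℕ) (j : Fin (t + 1)) :
    (truncGeom q t).real {j} = q ^ (j : ℕ) / ∑ l : Fin (t + 1), q ^ (l : ℕ) := by
  have hs := sum_fin_pow_pos hq t
  rw [measureReal_def, truncGeom_singleton, ENNReal.toReal_ofReal (by positivity)]

theorem le_truncGeom_real_singleton {q : ℝ} (hq : 0 < q) (t : ℕ) (j : Fin (t + 1)) :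
    q ^ (j : ℕ) * (1 - q) ≤ (truncGeom q t).real {j} := by
  have hs := sum_fin_pow_pos hq t
  rw [truncGeom_real_singleton hq, le_div_iff₀ hs, mul_assoc]
  refine mul_le_of_le_one_right (by positivity) ?_
  rw [Fin.sum_univ_eq_sum_range (fun l => q ^ l), mul_neg_geom_sum]
  linarith [pow_pos hq (t + 1)]

/-- A window of `m + 1` consecutive values has truncated geometric probability at least `m + 1`
times the lower bound for its largest value. -/
theorem le_truncGeom_real_window {q : ℝ} (hq : 0 < q) (hq1 : q < 1) {t a m e : ℕ}
    (h : a + m ≤ t) (he : a + m ≤ e) :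
    (m + 1) * (1 - q) * q ^ e ≤
      (truncGeom q t).real {x | a ≤ (x : ℕ) ∧ (x : ℕ) ≤ a + m} := by
  have hprob := isProbabilityMeasure_truncGeom hq t
  have hset : {x : Fin (t + 1) | a ≤ (x : ℕ) ∧ (x : ℕ) ≤ a + m} =
      (Finset.Icc (⟨a, by omega⟩ : Fin (t + 1)) ⟨a + m, by omega⟩ : Finset (Fin (t + 1))) := by
    ext x
    simp [Fin.le_def]
  rw [hset, ← sum_measureReal_singleton]
  have hcard : #(Finset.Icc (⟨a, by omega⟩ : Fin (t + 1)) ⟨a + m, by omega⟩) = m + 1 := by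
    rw [Fin.card_Icc]
    simp only
    omega
  have hle := card_nsmul_le_sum (Finset.Icc (⟨a, by omega⟩ : Fin (t + 1)) ⟨a + m, by omega⟩)
    (fun b => (truncGeom q t).real {b}) ((1 - q) * q ^ e) (fun x hx => by
      refine le_trans ?_ (le_truncGeom_real_singleton hq t x)
      rw [mul_comm]
      have hx' : (x : ℕ) ≤ a + m := (Finset.mem_Icc.1 hx).2
      have := pow_le_pow_of_le_one hq.le hq1.le (hx'.trans he)
      have : 0 ≤ 1 - q := by linarith
      gcongr)
  rw [hcard, nsmul_eq_mul] at hle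
  push_cast at hle
  linarith

/-- Under the Mallows measure the inversion code has independent truncated geometric
coordinates. -/
theorem mallowsProb_inversionCode {n : ℕ} {q : ℝ} (hq : 0 < q)
    (A : Set (∀ t : Fin n, Fin ((t : ℕ) + 1))) :
    mallowsProb n q {π | inversionCode π ∈ A} =
      (Measure.pi fun t : Fin n => truncGeom q t).real A := by
  classical
  have hprob := fun t : ℕ => isProbabilityMeasure_truncGeom hq t
  have hA : A = (univ.filter (· ∈ A) : Finset (∀ t : Fin n, Fin ((t : ℕ) + 1))) := by
    ext; simp
  conv_rhs => rw [hA, ← sum_measureReal_singleton, sum_filter]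
  rw [mallowsProb, ← (inversionCode_bijective n).sum_comp]
  refine sum_congr rfl fun π _ => ?_
  simp only [Set.indicator_apply, Set.mem_ofPred_eq]
  split_ifs with h
  · rw [measureReal_def, Measure.pi_singleton, ENNReal.toReal_prod, mallowsPMF_eq_prod]
    exact prod_congr rfl fun t _ => (truncGeom_real_singleton hq _ _).symm
  · rfl

theorem mallowsProb_mono {n : ℕ} {q : ℝ} (hq : 0 < q) {A B : Set (Equiv.Perm (Fin n))}
    (h : A ⊆ B) : mallowsProb n q A ≤ mallowsProb n q B :=
  sum_le_sum fun π _ => Set.indicator_le_indicator_of_subset h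
    (fun σ => div_nonneg (by positivity) (sum_nonneg fun _ _ => by positivity)) π

section Independence

variable {ι κ : Type*} [Fintype ι] {α : ι → Type*} [∀ i, Finite (α i)]
  [∀ i, MeasurableSpace (α i)] [∀ i, MeasurableSingletonClass (α i)]
  (μ : ∀ i, Measure (α i)) [∀ i, IsProbabilityMeasure (μ i)]

theorem pi_real_inter_of_dependsOn {A B : Set (∀ i, α i)} {S T : Finset ι} (hST : Disjoint S T)
    (hA : DependsOn (· ∈ A) (S : Set ι)) (hB : DependsOn (· ∈ B) (T : Set ι)) :
    (Measure.pi μ).real (A ∩ B) = (Measure.pi μ).real A * (Measure.pi μ).real B := by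
  have hind : iIndepFun (fun i (ω : ∀ i, α i) => ω i) (Measure.pi μ) :=
    iIndepFun_pi (X := fun _ x => x) fun i => aemeasurable_id
  have h := (hind.indepFun_finset S T hST fun i => measurable_pi_apply i)
  have hpre : ∀ {C : Set (∀ i, α i)} {U : Finset ι}, DependsOn (· ∈ C) (U : Set ι) →
      C = (fun (ω : ∀ i, α i) (i : U) => ω i) ⁻¹'
        ((fun (ω : ∀ i, α i) (i : U) => ω i) '' C) := by
    intro C U hC
    refine (Set.subset_preimage_image _ _).antisymm ?_
    rintro x ⟨y, hy, hxy⟩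
    have : (y ∈ C) = (x ∈ C) := hC fun i hi => congrFun hxy ⟨i, hi⟩
    exact this ▸ hy
  have hmul := h.measure_inter_preimage_eq_mul _ _
    (Set.toFinite ((fun (ω : ∀ i, α i) (i : S) => ω i) '' A)).measurableSet
    (Set.toFinite ((fun (ω : ∀ i, α i) (i : T) => ω i) '' B)).measurableSet
  rw [← hpre hA, ← hpre hB] at hmul
  rw [measureReal_def, hmul, ENNReal.toReal_mul, measureReal_def, measureReal_def]

theorem pi_real_biInter_of_dependsOn {E : κ → Set (∀ i, α i)} {S : κ → Finset ι} (J : Finset κ)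
    (hS : (J : Set κ).PairwiseDisjoint S) (hE : ∀ j ∈ J, DependsOn (· ∈ E j) (S j : Set ι)) :
    (Measure.pi μ).real (⋂ j ∈ J, E j) = ∏ j ∈ J, (Measure.pi μ).real (E j) := by
  classical
  induction J using Finset.induction_on with
  | empty => simp
  | insert a J ha ih =>
    rw [set_biInter_insert, prod_insert ha, ← ih (hS.subset (by simp))
      (fun j hj => hE j (mem_insert_of_mem hj))]
    refine pi_real_inter_of_dependsOn μ (T := J.biUnion S) ?_ (hE a (mem_insert_self _ _)) ?_
    · rw [disjoint_biUnion_right]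
      exact fun j hj => hS (by simp) (by simp [hj]) (by rintro rfl; exact ha hj)
    · intro x y hxy
      simp only [Set.mem_iInter, eq_iff_iff]
      refine forall₂_congr fun j hj => ?_
      exact iff_of_eq (hE j (mem_insert_of_mem hj) fun i hi => hxy i (by
        simp only [coe_biUnion, Set.mem_iUnion]
        exact ⟨j, hj, hi⟩))

theorem pi_real_biUnion_of_dependsOn {E : κ → Set (∀ i, α i)} {S : κ → Finset ι} (J : Finset κ)
    (hS : (J : Set κ).PairwiseDisjoint S) (hE : ∀ j ∈ J, DependsOn (· ∈ E j) (S j : Set ι)) :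
    (Measure.pi μ).real (⋃ j ∈ J, E j) = 1 - ∏ j ∈ J, (1 - (Measure.pi μ).real (E j)) := by
  have hcompl : ∀ A : Set (∀ i, α i),
      (Measure.pi μ).real Aᶜ = 1 - (Measure.pi μ).real A := fun A =>
    probReal_compl_eq_one_sub (Set.toFinite A).measurableSet
  have h := pi_real_biInter_of_dependsOn μ (E := fun j => (E j)ᶜ) J hS
    (fun j hj x y hxy => congrArg Not (hE j hj hxy))
  rw [← Set.compl_iUnion₂, hcompl] at h
  simp only [hcompl] at h
  linarith

end Independence

/-- The first time of group `i` in block `k`. Each block has length `L * (2 * m + 1)`, and its last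
`L * (m + 1)` times are divided into `L` groups of length `m + 1`. -/
def groupStart (L m k i : ℕ) : ℕ := k * (L * (2 * m + 1)) + L * m + i * (m + 1)

/-- The times of group `i` in block `k`. -/
def groupTimes (n L m k i : ℕ) : Finset (Fin n) :=
  {t | groupStart L m k i ≤ t ∧ (t : ℕ) < groupStart L m k i + (m + 1)}

/-- The codes whose entry at time `t` lies in the window of group `i` in block `k`. -/
def windowEvent (n L m k i : ℕ) (t : Fin n) : Set (∀ t : Fin n, Fin ((t : ℕ) + 1)) :=
  {c | t + i * m ≤ (c t : ℕ) + (k * (L * (2 * m + 1)) + L * m) ∧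
    (c t : ℕ) + (k * (L * (2 * m + 1)) + L * m) ≤ t + i * m + m}

/-- The codes with some entry of group `i` in block `k` inside the window of that group. -/
def groupEvent (n L m k i : ℕ) : Set (∀ t : Fin n, Fin ((t : ℕ) + 1)) :=
  ⋃ t ∈ groupTimes n L m k i, windowEvent n L m k i t

theorem groupStart_add_le_of_lt {L m k i j : ℕ} (hij : i < j) :
    groupStart L m k i + (m + 1) ≤ groupStart L m k j := by
  have : (i + 1) * (m + 1) ≤ j * (m + 1) := Nat.mul_le_mul_right _ hij
  unfold groupStart
  linarith

theorem groupStart_add_le_block {L m k i : ℕ} (hi : i < L) :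
    groupStart L m k i + (m + 1) ≤ (k + 1) * (L * (2 * m + 1)) := by
  have : (i + 1) * (m + 1) ≤ L * (m + 1) := Nat.mul_le_mul_right _ hi
  unfold groupStart
  linarith

theorem block_le_groupStart (L m k i : ℕ) : k * (L * (2 * m + 1)) ≤ groupStart L m k i := by
  unfold groupStart
  omega

theorem groupTimes_disjoint_of_lt {n L m k i j : ℕ} (hij : i < j) :
    Disjoint (groupTimes n L m k i) (groupTimes n L m k j) := by
  have h := groupStart_add_le_of_lt (L := L) (m := m) (k := k) hij
  rw [Finset.disjoint_left]
  intro t ht ht'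
  simp only [groupTimes, mem_filter_univ] at ht ht'
  omega

theorem groupTimes_pairwiseDisjoint (n L m k : ℕ) (J : Set ℕ) :
    J.PairwiseDisjoint (groupTimes n L m k) := by
  intro i _ j _ hij
  rcases hij.lt_or_gt with h | h
  · exact groupTimes_disjoint_of_lt h
  · exact (groupTimes_disjoint_of_lt h).symm

/-- The times of block `k`. -/
def blockTimes (n L m k : ℕ) : Finset (Fin n) := (range L).biUnion (groupTimes n L m k)

theorem blockTimes_disjoint_of_lt {n L m k l : ℕ} (hkl : k < l) :
    Disjoint (blockTimes n L m k) (blockTimes n L m l) := by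
  rw [Finset.disjoint_left]
  intro t ht ht'
  simp only [blockTimes, groupTimes, mem_biUnion, mem_filter_univ, Finset.mem_range] at ht ht'
  obtain ⟨i, hi, hti⟩ := ht
  obtain ⟨j, hj, htj⟩ := ht'
  have h1 := groupStart_add_le_block (m := m) (k := k) hi
  have h2 := block_le_groupStart L m l j
  have h3 : (k + 1) * (L * (2 * m + 1)) ≤ l * (L * (2 * m + 1)) := Nat.mul_le_mul_right _ hkl
  omega

theorem blockTimes_pairwiseDisjoint (n L m : ℕ) (J : Set ℕ) :
    J.PairwiseDisjoint (blockTimes n L m) := by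
  intro k _ l _ hkl
  rcases hkl.lt_or_gt with h | h
  · exact blockTimes_disjoint_of_lt h
  · exact (blockTimes_disjoint_of_lt h).symm

theorem card_groupTimes {n L m k i : ℕ} (h : groupStart L m k i + (m + 1) ≤ n) :
    #(groupTimes n L m k i) = m + 1 := by
  have himage : (groupTimes n L m k i).map Fin.valEmbedding =
      Finset.Ico (groupStart L m k i) (groupStart L m k i + (m + 1)) := by
    ext x
    simp only [groupTimes, mem_map, mem_filter_univ, Fin.valEmbedding_apply, Finset.mem_Ico]
    exact ⟨by rintro ⟨t, ht, rfl⟩; exact ht, fun hx => ⟨⟨x, by omega⟩, hx, rfl⟩⟩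
  rw [← card_map, himage, Nat.card_Ico]
  omega

theorem dependsOn_windowEvent (n L m k i : ℕ) (t : Fin n) :
    DependsOn (· ∈ windowEvent n L m k i t) (({t} : Finset (Fin n)) : Set (Fin n)) := by
  intro x y hxy
  have : x t = y t := hxy t (by simp)
  simp only [windowEvent, Set.mem_ofPred_eq, this]

theorem dependsOn_groupEvent (n L m k i : ℕ) :
    DependsOn (· ∈ groupEvent n L m k i) (groupTimes n L m k i : Set (Fin n)) := by
  intro x y hxy
  simp only [groupEvent, Set.mem_iUnion, eq_iff_iff]
  refine exists_congr fun t => exists_congr fun ht => ?_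
  exact iff_of_eq (dependsOn_windowEvent n L m k i t fun s hs => hxy s (by
    rw [Finset.mem_coe, Finset.mem_singleton] at hs
    exact hs ▸ ht))

/-- If a code meets every group of a block, the permutation has a decreasing subsequence
of length `L`. -/
theorem le_LDS_of_groupEvent {n L m k : ℕ} {π : Equiv.Perm (Fin n)}
    (h : ∀ i < L, inversionCode π ∈ groupEvent n L m k i) : L ≤ LDS π := by
  have h' : ∀ i : Fin L, ∃ t ∈ groupTimes n L m k i,
      inversionCode π ∈ windowEvent n L m k i t := by
    intro i
    have := h i i.isLt
    simpa [groupEvent] using this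
  choose f hf hw using h'
  simp only [groupTimes, mem_filter_univ] at hf
  simp only [windowEvent, Set.mem_ofPred_eq] at hw
  have hmono : StrictMono f := by
    intro i j hij
    have := groupStart_add_le_of_lt (L := L) (m := m) (k := k) (show (i : ℕ) < j from hij)
    have := hf i
    have := hf j
    rw [Fin.lt_def]
    omega
  refine le_LDS f hmono fun i j hij => ?_
  refine apply_lt_apply_of_inversionCode π (hmono hij) ?_
  have hij' : ((i : ℕ) + 1) * m ≤ j * m := Nat.mul_le_mul_right _ hij
  have := hw i
  have := hw j
  linarith

theorem le_windowEvent_real {n L m k i : ℕ} {q : ℝ} (hq : 0 < q) (hq1 : q < 1) (hi : i < L)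
    {t : Fin n} (ht : t ∈ groupTimes n L m k i) :
    (m + 1) * (1 - q) * q ^ (i * (2 * m + 1) + 2 * m) ≤
      (Measure.pi fun t : Fin n => truncGeom q t).real (windowEvent n L m k i t) := by
  have hprob := fun t : ℕ => isProbabilityMeasure_truncGeom hq t
  simp only [groupTimes, mem_filter_univ] at ht
  simp only [groupStart] at ht
  have him : (i + 1) * m ≤ L * m := Nat.mul_le_mul_right _ hi
  obtain ⟨d, hd⟩ : ∃ d, (t : ℕ) = k * (L * (2 * m + 1)) + L * m + d :=
    Nat.exists_eq_add_of_le (by omega)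
  have hset : windowEvent n L m k i t = Function.eval t ⁻¹'
      {x | d + i * m ≤ (x : ℕ) ∧ (x : ℕ) ≤ d + i * m + m} := by
    ext c
    simp only [windowEvent, Set.mem_ofPred_eq, Set.mem_preimage, Function.eval]
    omega
  rw [hset, (measurePreserving_eval (fun t : Fin n => truncGeom q t) t).measureReal_preimage
    (Set.toFinite _).measurableSet.nullMeasurableSet]
  refine le_truncGeom_real_window hq hq1 ?_ ?_
  · have : i * m + m ≤ L * m := by linarith
    omega
  · linarith

theorem le_groupEvent_real {n L m k i : ℕ} {q : ℝ} (hq : 0 < q) (hq1 : q < 1) (hi : i < L)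
    (hn : (k + 1) * (L * (2 * m + 1)) ≤ n) :
    1 - (1 - (m + 1) * (1 - q) * q ^ (i * (2 * m + 1) + 2 * m)) ^ (m + 1) ≤
      (Measure.pi fun t : Fin n => truncGeom q t).real (groupEvent n L m k i) := by
  have hprob := fun t : ℕ => isProbabilityMeasure_truncGeom hq t
  rw [groupEvent, pi_real_biUnion_of_dependsOn _ (S := fun t => {t})
    (groupTimes n L m k i) (fun s _ t _ hst => by simpa using hst)
    (fun t _ => dependsOn_windowEvent n L m k i t)]
  have hcard := card_groupTimes ((groupStart_add_le_block (m := m) (k := k) hi).trans hn)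
  rw [← hcard, ← prod_const]
  refine sub_le_sub_left (prod_le_prod (fun t _ => sub_nonneg.2 measureReal_le_one) ?_) _
  intro t ht
  exact sub_le_sub_left (le_windowEvent_real hq hq1 hi ht) _

theorem le_mallowsProb_LDS {n L m K : ℕ} {q p : ℝ} (hq : 0 < q) (hq1 : q < 1)
    (hn : K * (L * (2 * m + 1)) ≤ n)
    (h0 : ∀ i < L, 0 ≤ 1 - (1 - (m + 1) * (1 - q) * q ^ (i * (2 * m + 1) + 2 * m)) ^ (m + 1))
    (hp : p ≤ ∏ i ∈ range L,
      (1 - (1 - (m + 1) * (1 - q) * q ^ (i * (2 * m + 1) + 2 * m)) ^ (m + 1))) :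
    1 - (1 - p) ^ K ≤ mallowsProb n q {π | L ≤ LDS π} := by
  have hprob := fun t : ℕ => isProbabilityMeasure_truncGeom hq t
  have hsub : {π : Equiv.Perm (Fin n) |
      inversionCode π ∈ ⋃ k ∈ range K, ⋂ i ∈ range L, groupEvent n L m k i} ⊆
      {π | L ≤ LDS π} := by
    intro π hπ
    simp only [Set.mem_ofPred_eq, Set.mem_iUnion, Set.mem_iInter, Finset.mem_range] at hπ ⊢
    obtain ⟨k, -, hk⟩ := hπ
    exact le_LDS_of_groupEvent hk
  refine le_trans ?_ (mallowsProb_mono hq hsub)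
  rw [mallowsProb_inversionCode hq, pi_real_biUnion_of_dependsOn _ (S := blockTimes n L m) (range K)
    (blockTimes_pairwiseDisjoint n L m _)]
  · conv_lhs => rw [← card_range K, ← prod_const]
    refine sub_le_sub_left (prod_le_prod (fun k _ => sub_nonneg.2 measureReal_le_one) ?_) _
    intro k hk
    refine sub_le_sub_left (hp.trans ?_) _
    rw [pi_real_biInter_of_dependsOn _ (range L) (groupTimes_pairwiseDisjoint n L m k _)
      (fun i _ => dependsOn_groupEvent n L m k i)]
    refine prod_le_prod (fun i hi => h0 i (Finset.mem_range.1 hi)) fun i hi => ?_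
    refine le_groupEvent_real hq hq1 (Finset.mem_range.1 hi) (le_trans ?_ hn)
    exact Nat.mul_le_mul_right _ (Finset.mem_range.1 hk)
  · intro k _ x y hxy
    simp only [Set.mem_iInter, eq_iff_iff]
    refine forall₂_congr fun i hi => ?_
    exact iff_of_eq (dependsOn_groupEvent n L m k i fun t ht => hxy t
      (Finset.mem_coe.2 (mem_biUnion.2 ⟨i, hi, ht⟩)))

theorem le_mallowsProb_LDS_consecutive {n L : ℕ} {q : ℝ} (hq : 0 < q) (hq1 : q < 1) :
    1 - (1 - q ^ (L * (L - 1) / 2) * (1 - q) ^ L) ^ (n / L) ≤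
      mallowsProb n q {π | L ≤ LDS π} := by
  have h1 : 0 < 1 - q := by linarith
  refine le_mallowsProb_LDS (m := 0) hq hq1 ?_ ?_ ?_
  · simpa using Nat.div_mul_le_self n L
  · intro i _
    simp
    positivity
  · rw [← Finset.sum_range_id, ← prod_pow_eq_pow_sum]
    simp [prod_mul_distrib, mul_comm]

theorem half_mul_le_one_sub_one_sub_pow {x : ℝ} {s : ℕ} (hx : 0 ≤ x) (hx1 : x ≤ 1)
    (hs : s * x ≤ 1) : s * x / 2 ≤ 1 - (1 - x) ^ s := by
  have h0 : 0 ≤ s * x := by positivity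
  have h1 : 1 + s * x ≤ (1 + x) ^ s := one_add_mul_le_pow (by linarith) s
  have h2 : (1 - x) ^ s * (1 + x) ^ s ≤ 1 := by
    rw [← mul_pow]
    exact pow_le_one₀ (by nlinarith) (by nlinarith)
  have h3 : 0 ≤ (1 - x) ^ s := pow_nonneg (by linarith) s
  have h4 : (1 - x) ^ s * (1 + s * x) ≤ 1 := (mul_le_mul_of_nonneg_left h1 h3).trans h2
  nlinarith

theorem exp_neg_four_le_pow {q : ℝ} (hq : 1 / 2 ≤ q) (hq1 : q < 1) {e : ℕ}
    (he : e * (1 - q) ≤ 2) : Real.exp (-4) ≤ q ^ e := by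
  have hq0 : 0 < q := by linarith
  have h1 : 1 - q⁻¹ ≤ Real.log q := Real.one_sub_inv_le_log_of_pos hq0
  have h2 : -2 * (1 - q) ≤ 1 - q⁻¹ := by
    have h3 : q * q⁻¹ = 1 := mul_inv_cancel₀ hq0.ne'
    have h4 : q⁻¹ ≤ 2 := by
      rw [inv_le_comm₀ hq0 two_pos]
      linarith
    nlinarith
  rw [← Real.exp_log (pow_pos hq0 e), Real.log_pow, Real.exp_le_exp]
  have : (e : ℝ) * (-2 * (1 - q)) ≤ e * Real.log q :=
    mul_le_mul_of_nonneg_left (h2.trans h1) (Nat.cast_nonneg e)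
  linarith

theorem le_mallowsProb_LDS_groups {n L : ℕ} {q : ℝ} (hq : 1 / 2 ≤ q) (hq1 : q < 1)
    (hL : 1 / √(1 - q) ≤ L) (hL1 : L ≤ 1 / (1 - q)) :
    1 - (1 - (Real.exp (-4) / 8 / ((1 - q) * L ^ 2)) ^ L) ^ ⌊(n : ℝ) * (1 - q) / 4⌋₊ ≤
      mallowsProb n q {π | L ≤ LDS π} := by
  have hq0 : 0 < q := by linarith
  have h1 : 0 < 1 - q := by linarith
  have hL0 : (0 : ℝ) < L := lt_of_lt_of_le (by positivity) hL
  have hLsq : 1 ≤ (1 - q) * L ^ 2 := by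
    have := mul_self_le_mul_self (by positivity) hL
    rw [div_mul_div_comm, Real.mul_self_sqrt h1.le, div_le_iff₀ h1] at this
    linarith
  have hL1' : L * (1 - q) ≤ 1 := (le_div_iff₀ h1).1 hL1
  have hx1 : 1 ≤ 1 / (L * (1 - q)) := by rwa [le_div_iff₀ (by positivity), one_mul]
  obtain ⟨m, hm⟩ : ∃ m, ⌊1 / (L * (1 - q))⌋₊ = m + 1 :=
    Nat.exists_eq_add_of_le' (Nat.le_floor (by simpa using hx1))
  have hs : ((m : ℝ) + 1) * (L * (1 - q)) ≤ 1 := by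
    have := Nat.floor_le (zero_le_one.trans hx1)
    rw [hm, le_div_iff₀ (by positivity)] at this
    exact_mod_cast this
  have hs' : 1 ≤ 2 * ((m : ℝ) + 1) * (L * (1 - q)) := by
    have := Nat.lt_floor_add_one (1 / (L * (1 - q)))
    rw [hm, div_lt_iff₀ (by positivity)] at this
    push_cast at this
    have : 0 ≤ (m : ℝ) * (L * (1 - q)) := by positivity
    linarith
  have hL2 : (1 : ℝ) ≤ L := by
    have : 0 < L := by exact_mod_cast hL0
    exact_mod_cast this
  have hs1 : ((m : ℝ) + 1) * (1 - q) ≤ 1 := by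
    refine le_trans ?_ hs
    have : (1 - q) ≤ L * (1 - q) := le_mul_of_one_le_left h1.le hL2
    gcongr
  have hs2 : ((m : ℝ) + 1) * ((m + 1) * (1 - q)) ≤ 1 := by
    have h2 := mul_le_mul hs hs (by positivity) zero_le_one
    have h3 : ((m : ℝ) + 1) * (L * (1 - q)) * ((m + 1) * (L * (1 - q))) =
      (m + 1) * ((m + 1) * (1 - q)) * ((1 - q) * L ^ 2) := by ring
    rw [h3] at h2
    have : 0 ≤ ((m : ℝ) + 1) * ((m + 1) * (1 - q)) := by positivity
    nlinarith
  have hfactor : ∀ i < L, Real.exp (-4) / 8 / ((1 - q) * L ^ 2) ≤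
      1 - (1 - (m + 1) * (1 - q) * q ^ (i * (2 * m + 1) + 2 * m)) ^ (m + 1) := by
    intro i hi
    set e := i * (2 * m + 1) + 2 * m with he
    have heL : e ≤ L * (2 * m + 1) := by
      have : (i + 1) * (2 * m + 1) ≤ L * (2 * m + 1) := Nat.mul_le_mul_right _ hi
      linarith
    have heL' : (e : ℝ) ≤ L * (2 * m + 1) := by exact_mod_cast heL
    have hexp : Real.exp (-4) ≤ q ^ e := exp_neg_four_le_pow hq hq1 (by
      have : (e : ℝ) * (1 - q) ≤ L * (2 * m + 1) * (1 - q) := by gcongr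
      nlinarith)
    have hqe : q ^ e ≤ 1 := pow_le_one₀ hq0.le hq1.le
    have hnn : 0 ≤ ((m : ℝ) + 1) * (1 - q) := by positivity
    have hle : ((m : ℝ) + 1) * (1 - q) * q ^ e ≤ (m + 1) * (1 - q) :=
      mul_le_of_le_one_right hnn hqe
    refine le_trans ?_ (half_mul_le_one_sub_one_sub_pow (s := m + 1) (by positivity)
      (hle.trans hs1) ?_)
    · push_cast
      rw [div_le_iff₀ (by positivity)]
      have h2 : 1 ≤ 2 * ((m : ℝ) + 1) * (L * (1 - q)) * (2 * (m + 1) * (L * (1 - q))) :=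
        one_le_mul_of_one_le_of_one_le hs' hs'
      have h3 := mul_le_mul hexp h2 zero_le_one (by positivity)
      linarith
    · push_cast
      exact (mul_le_mul_of_nonneg_left hle (by positivity)).trans hs2
  have hc : 0 ≤ Real.exp (-4) / 8 / ((1 - q) * (L : ℝ) ^ 2) := by positivity
  refine le_mallowsProb_LDS (m := m) hq0 hq1 ?_ (fun i hi => hc.trans (hfactor i hi)) ?_
  · have hK : (⌊(n : ℝ) * (1 - q) / 4⌋₊ : ℝ) ≤ n * (1 - q) / 4 := Nat.floor_le (by positivity)
    have h2 : (L : ℝ) * (2 * m + 1) * (1 - q) ≤ 2 := by nlinarith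
    have h3 : (⌊(n : ℝ) * (1 - q) / 4⌋₊ : ℝ) * (L * (2 * m + 1)) ≤ n := by
      have h4 := mul_le_mul_of_nonneg_right hK (show (0 : ℝ) ≤ L * (2 * m + 1) by positivity)
      have h5 := mul_le_mul_of_nonneg_left h2 (Nat.cast_nonneg (α := ℝ) n)
      linarith
    exact_mod_cast h3
  · conv_lhs => rw [← card_range L, ← prod_const]
    exact prod_le_prod (fun i _ => by simpa using hc)
      (fun i hi => by simpa using hfactor i (Finset.mem_range.1 hi))

/-- There are absolute constants `C, c > 0` so that for `n≥2`, `0<q<1`,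
`π ~ μ_{n,q}`: (a) if `1/2 ≤ q ≤ 1−4/n` and `C/√(1−q) ≤ L ≤ 1/(1−q)` then
`P(LDS(π) ≥ L) ≥ 1 − (1 − (c/((1−q)L²))^L)^{⌊n(1−q)/4⌋}`; (b) for every integer `L ≥ 2`,
`P(LDS(π) ≥ L) ≥ 1 − (1 − q^{L(L−1)/2}(1−q)^L)^{⌊n/L⌋}`. -/
theorem mallows_LDS_lower_tail :
    ∃ C c : ℝ, 0 < C ∧ 0 < c ∧
      ∀ (n : ℕ) (q : ℝ), 2 ≤ n → 0 < q → q < 1 →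
        ((∀ L : ℕ, 1 / 2 ≤ q → q ≤ 1 - 4 / (n : ℝ) →
            C / Real.sqrt (1 - q) ≤ (L : ℝ) → (L : ℝ) ≤ 1 / (1 - q) →
            1 - (1 - (c / ((1 - q) * (L : ℝ) ^ 2)) ^ L) ^ ⌊(n : ℝ) * (1 - q) / 4⌋₊ ≤
              mallowsProb n q {π | L ≤ LDS π}) ∧
         (∀ L : ℕ, 2 ≤ L →
            1 - (1 - q ^ (L * (L - 1) / 2) * (1 - q) ^ L) ^ (n / L) ≤
              mallowsProb n q {π | L ≤ LDS π})) := by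
  refine ⟨1, Real.exp (-4) / 8, one_pos, by positivity, fun n q _ hq hq1 => ⟨?_, ?_⟩⟩
  · intro L hq2 _ hL hL1
    exact le_mallowsProb_LDS_groups hq2 hq1 hL hL1
  · intro L _
    exact le_mallowsProb_LDS_consecutive hq hq1
end

section
/- There exist absolute constants C, c > 0 such that for every integer n≥1, every real q with 1/2 ≤ q ≤ 1 − 4/n, and every integer L with 2 ≤ L < c/√(1−q), if π is distributed according to the (n,q)-Mallows measure, then P(LDS(π) < L) ≤ (C(1−q)L²)^{n/L}. -/
open Finset

/-- `LDS` is at least the size of any set of positions on which the permutation is decreasing. -/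
lemma card_le_LDS {n : ℕ} (π : Equiv.Perm (Fin n)) (s : Finset (Fin n))
    (hs : StrictAntiOn π (s : Set (Fin n))) : s.card ≤ LDS π := by
  refine le_csSup ⟨n, ?_⟩ ⟨s.orderEmbOfFin rfl, (s.orderEmbOfFin rfl).strictMono, ?_⟩
  · rintro m ⟨f, hf, -⟩
    simpa using Fintype.card_le_of_injective f hf.injective
  · intro i j hij
    exact hs (s.orderEmbOfFin_mem rfl i) (s.orderEmbOfFin_mem rfl j)
      ((s.orderEmbOfFin rfl).strictMono hij)

/-- A permutation without decreasing subsequences of length `L` is a union of `L` increasing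
subsequences. -/
lemma exists_coloring_of_LDS_lt {n L : ℕ} (π : Equiv.Perm (Fin n)) (h : LDS π < L) :
    ∃ g : Fin n → Fin L, ∀ i j, i < j → π j < π i → g i ≠ g j := by
  classical
  let F : Fin n → Finset (Finset (Fin n)) := fun i => Finset.univ.filter fun s =>
    StrictAntiOn π (s : Set (Fin n)) ∧ ∀ x ∈ s, x < i ∧ π i < π x
  let d : Fin n → ℕ := fun i => (F i).sup Finset.card
  have hd : ∀ i, ∃ s ∈ F i, d i = s.card := fun i =>
    Finset.exists_mem_eq_sup (F i) ⟨∅, by simp [F, StrictAntiOn]⟩ _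
  have hins : ∀ i, ∀ s ∈ F i, i ∉ s ∧ StrictAntiOn π ((insert i s : Finset (Fin n)) : Set _) := by
    intro i s hs
    obtain ⟨h1, h2⟩ := (Finset.mem_filter.1 hs).2
    refine ⟨fun hi => lt_irrefl _ (h2 i hi).1, ?_⟩
    intro x hx y hy hxy
    simp only [Finset.coe_insert, Set.mem_insert_iff, Finset.mem_coe] at hx hy
    rcases hx with rfl | hx <;> rcases hy with rfl | hy
    · exact absurd hxy (lt_irrefl _)
    · exact absurd hxy (h2 y hy).1.asymm
    · exact (h2 x hx).2
    · exact h1 hx hy hxy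
  have hlt : ∀ i, d i < L := by
    intro i
    obtain ⟨s, hs, hc⟩ := hd i
    have := card_le_LDS π _ (hins i s hs).2
    rw [Finset.card_insert_of_notMem (hins i s hs).1] at this
    omega
  refine ⟨fun i => ⟨d i, hlt i⟩, fun i j hij hπ heq => ?_⟩
  obtain ⟨s, hs, hc⟩ := hd i
  have hmem : insert i s ∈ F j := by
    refine Finset.mem_filter.2 ⟨Finset.mem_univ _, (hins i s hs).2, fun x hx => ?_⟩
    rcases Finset.mem_insert.1 hx with rfl | hx
    · exact ⟨hij, hπ⟩
    · have := (Finset.mem_filter.1 hs).2.2 x hx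
      exact ⟨this.1.trans hij, hπ.trans this.2⟩
  have hle : (insert i s).card ≤ d j := Finset.le_sup (f := Finset.card) hmem
  rw [Finset.card_insert_of_notMem (hins i s hs).1] at hle
  have : d i = d j := congrArg Fin.val heq
  omega

/-- A permutation that preserves a coloring and is increasing on each color class is trivial. -/
lemma perm_eq_one_of_strictMono_on_colors {n : ℕ} {α : Type*} (τ : Equiv.Perm (Fin n))
    (a : Fin n → α) (ha : ∀ i, a (τ i) = a i)
    (hτ : ∀ i j, a i = a j → i < j → τ i < τ j) : τ = 1 := by
  refine Equiv.ext fun i => ?_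
  induction i using WellFoundedLT.induction with
  | _ i ih =>
    rcases lt_trichotomy (τ i) i with h | h | h
    · exact τ.injective (ih _ h)
    · exact h
    · exfalso
      have hj : τ (τ.symm i) = i := τ.apply_symm_apply i
      have haj : a i = a (τ.symm i) := by rw [← ha (τ.symm i), hj]
      rcases lt_trichotomy (τ.symm i) i with h' | h' | h'
      · have := ih _ h'
        rw [hj] at this
        exact h'.ne this.symm
      · rw [h'] at hj
        exact h.ne' hj
      · have := hτ _ _ haj h'
        rw [hj] at this
        exact h.asymm this

/-- There are at most `L ^ (2 n)` permutations without decreasing subsequences of length `L`. -/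
lemma card_LDS_lt_le (n L : ℕ) [DecidablePred fun π : Equiv.Perm (Fin n) => LDS π < L] :
    (Finset.univ.filter fun π : Equiv.Perm (Fin n) => LDS π < L).card ≤ L ^ n * L ^ n := by
  classical
  choose g hg using fun π : {π : Equiv.Perm (Fin n) // LDS π < L} =>
    exists_coloring_of_LDS_lt π.1 π.2
  have hinj : Function.Injective
      fun π : {π : Equiv.Perm (Fin n) // LDS π < L} => (g π, g π ∘ π.1.symm) := by
    rintro π ρ h
    obtain ⟨h1, h2⟩ := Prod.mk.inj h
    have hcol : ∀ i, g π (ρ.1.symm (π.1 i)) = g π i := fun i => by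
      have := congrFun h2 (π.1 i)
      simpa [h1] using this.symm
    have hone : π.1.trans ρ.1.symm = 1 := by
      refine perm_eq_one_of_strictMono_on_colors _ (g π) hcol fun i j hij hlt => ?_
      have hπ : π.1 i < π.1 j :=
        lt_of_le_of_ne (not_lt.1 fun h' => hg π i j hlt h' hij) (π.1.injective.ne hlt.ne)
      refine lt_of_le_of_ne (not_lt.1 fun h' => ?_)
        ((π.1.trans ρ.1.symm).injective.ne hlt.ne)
      refine hg ρ _ _ h' (by simpa using hπ) ?_
      rw [← h1]
      exact (hcol j).trans (hij.symm.trans (hcol i).symm)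
    refine Subtype.ext (Equiv.ext fun i => ?_)
    have := DFunLike.congr_fun hone i
    exact ρ.1.symm_apply_eq.1 this
  have := Fintype.card_le_of_injective _ hinj
  rw [Fintype.card_subtype] at this
  simpa using this

/-- The permutation whose first value is `p` and whose remaining values are ordered as in `σ`. -/
def permCons {n : ℕ} (x : Fin (n + 1) × Equiv.Perm (Fin n)) : Equiv.Perm (Fin (n + 1)) :=
  (finSuccEquiv n).trans ((Equiv.optionCongr x.2).trans (finSuccEquiv' x.1).symm)

@[simp] lemma permCons_zero {n : ℕ} (x : Fin (n + 1) × Equiv.Perm (Fin n)) :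
    permCons x 0 = x.1 := by
  simp [permCons]

@[simp] lemma permCons_succ {n : ℕ} (x : Fin (n + 1) × Equiv.Perm (Fin n)) (i : Fin n) :
    permCons x i.succ = x.1.succAbove (x.2 i) := by
  simp [permCons]

lemma permCons_injective (n : ℕ) : Function.Injective (permCons (n := n)) := by
  rintro ⟨p, σ⟩ ⟨p', σ'⟩ h
  obtain rfl : p = p' := by simpa using DFunLike.congr_fun h 0
  obtain rfl : σ = σ' := Equiv.ext fun i => by simpa using DFunLike.congr_fun h i.succ
  rfl

lemma mallowsInv_eq_sum {n : ℕ} (π : Equiv.Perm (Fin n)) :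
    mallowsInv π = ∑ i, ∑ j, if i < j ∧ π j < π i then 1 else 0 := by
  rw [mallowsInv, Finset.card_filter, ← Finset.univ_product_univ, Finset.sum_product]

lemma mallowsInv_permCons {n : ℕ} (x : Fin (n + 1) × Equiv.Perm (Fin n)) :
    mallowsInv (permCons x) = x.1 + mallowsInv x.2 := by
  have hcard : ∑ j : Fin n, (if (x.2 j).castSucc < x.1 then 1 else 0) = (x.1 : ℕ) := by
    rw [Equiv.sum_comp x.2 fun k : Fin n => if k.castSucc < x.1 then 1 else 0,
      ← Finset.card_filter]
    have := Fin.card_filter_val_lt (n := n) (m := x.1)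
    rw [min_eq_right (Nat.lt_succ_iff.1 x.1.2)] at this
    exact this
  rw [mallowsInv_eq_sum, mallowsInv_eq_sum, Fin.sum_univ_succ]
  simp only [Fin.sum_univ_succ]
  simp [Fin.succAbove_lt_iff_castSucc_lt, hcard]

/-- Recursive lower bound on the normalizing constant. -/
lemma sum_pow_mallowsInv_succ_ge (n : ℕ) {q : ℝ} (hq : 0 ≤ q) :
    (∑ k ∈ Finset.range (n + 1), q ^ k) * ∑ σ : Equiv.Perm (Fin n), q ^ mallowsInv σ ≤
      ∑ σ : Equiv.Perm (Fin (n + 1)), q ^ mallowsInv σ := by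
  classical
  calc _ = ∑ x : Fin (n + 1) × Equiv.Perm (Fin n), q ^ mallowsInv (permCons x) := by
        rw [← Fin.sum_univ_eq_sum_range, Finset.sum_mul_sum, ← Finset.univ_product_univ,
          Finset.sum_product]
        simp only [mallowsInv_permCons, pow_add]
    _ = ∑ σ ∈ Finset.univ.map ⟨permCons, permCons_injective n⟩, q ^ mallowsInv σ := by
        rw [Finset.sum_map]; rfl
    _ ≤ _ := Finset.sum_le_sum_of_subset_of_nonneg (Finset.subset_univ _)
        fun _ _ _ => pow_nonneg hq _

lemma prod_geom_sum_le_sum_pow_mallowsInv (n : ℕ) {q : ℝ} (hq : 0 ≤ q) :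
    ∏ i ∈ Finset.range n, ∑ k ∈ Finset.range (i + 1), q ^ k ≤
      ∑ σ : Equiv.Perm (Fin n), q ^ mallowsInv σ := by
  induction n with
  | zero => simp [mallowsInv]
  | succ n ih =>
    rw [Finset.prod_range_succ, mul_comm]
    refine le_trans ?_ (sum_pow_mallowsInv_succ_ge n hq)
    exact mul_le_mul_of_nonneg_left ih (Finset.sum_nonneg fun _ _ => pow_nonneg hq _)

lemma geom_sum_ge {n i : ℕ} {q : ℝ} (hq : 0 ≤ q) (hn : 1 ≤ n) (hqn : q ≤ 1 - 4 / (n : ℝ))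
    (hi : i ≤ n) :
    4 / (5 * n * (1 - q)) * i ≤ ∑ k ∈ Finset.range i, q ^ k := by
  have hn0 : (0 : ℝ) < n := by exact_mod_cast hn
  have h4 : 4 / (n : ℝ) ≤ 1 - q := by linarith
  have hε : 0 < 1 - q := lt_of_lt_of_le (by positivity) h4
  have h4' : 4 ≤ (1 - q) * n := (div_le_iff₀ hn0).1 h4
  have hi' : (i : ℝ) ≤ n := by exact_mod_cast hi
  set S := ∑ k ∈ Finset.range i, q ^ k with hS
  have hgeom : S * (1 - q) = 1 - q ^ i := by
    have := geom_sum_mul q i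
    linarith
  have hbern : q ^ i * (1 + i * (1 - q)) ≤ 1 := by
    have h1 : 1 + i * (1 - q) ≤ (1 + (1 - q)) ^ i :=
      one_add_mul_le_pow (by linarith) i
    calc q ^ i * (1 + i * (1 - q)) ≤ q ^ i * (1 + (1 - q)) ^ i := by gcongr
      _ = (q * (1 + (1 - q))) ^ i := (mul_pow _ _ _).symm
      _ ≤ 1 := pow_le_one₀ (mul_nonneg hq (by linarith)) (by nlinarith [sq_nonneg (1 - q)])
  rw [div_mul_eq_mul_div, div_le_iff₀ (by positivity)]
  have hi0 : (0 : ℝ) ≤ i := Nat.cast_nonneg i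
  have hA : 0 < 1 + i * (1 - q) := by positivity
  have h5 : (1 - q ^ i) * (1 + i * (1 - q)) ≥ i * (1 - q) := by nlinarith
  have h6 : 4 * i * (1 + i * (1 - q)) ≤ 5 * n * (i * (1 - q)) := by
    nlinarith [mul_le_mul_of_nonneg_left h4' hi0,
      mul_le_mul_of_nonneg_left hi' (mul_nonneg hi0 hε.le)]
  have h7 : 4 * i * (1 + i * (1 - q)) ≤ 5 * n * (1 - q ^ i) * (1 + i * (1 - q)) := by
    nlinarith [mul_le_mul_of_nonneg_left h5 hn0.le]
  have h8 := le_of_mul_le_mul_right h7 hA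
  rw [← hgeom] at h8
  linarith

/-- Exponential lower bound on the normalizing constant. -/
lemma inv_pow_le_sum_pow_mallowsInv {n : ℕ} {q : ℝ} (hq : 0 ≤ q) (hn : 1 ≤ n)
    (hqn : q ≤ 1 - 4 / (n : ℝ)) :
    ((4 * (1 - q)) ^ n)⁻¹ ≤ ∑ σ : Equiv.Perm (Fin n), q ^ mallowsInv σ := by
  have hn0 : (0 : ℝ) < n := by exact_mod_cast hn
  have hε : 0 < 1 - q := lt_of_lt_of_le (div_pos (by norm_num) hn0)
    (by linarith : 4 / (n : ℝ) ≤ 1 - q)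
  refine le_trans ?_ (prod_geom_sum_le_sum_pow_mallowsInv n hq)
  calc ((4 * (1 - q)) ^ n)⁻¹ ≤ (4 / (5 * n * (1 - q))) ^ n * n.factorial := by
        have hf := Real.pow_div_factorial_le_exp (n : ℝ) hn0.le n
        have hf0 : (0 : ℝ) < n.factorial := by exact_mod_cast n.factorial_pos
        rw [div_le_iff₀ hf0] at hf
        have he : Real.exp n ≤ (16 / 5) ^ n := by
          rw [← Real.exp_one_pow]
          gcongr
          linarith [Real.exp_one_lt_d9]
        have hx : (n : ℝ) ^ n ≤ (16 / 5) ^ n * n.factorial :=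
          hf.trans (mul_le_mul_of_nonneg_right he hf0.le)
        have hr : (4 / (5 * n * (1 - q))) ^ n * (n.factorial : ℝ) =
            ((4 * (1 - q)) ^ n)⁻¹ * (((16 / 5) ^ n * n.factorial) / (n : ℝ) ^ n) := by
          rw [show 4 / (5 * n * (1 - q)) = (4 * (1 - q))⁻¹ * (16 / 5) / (n : ℝ) by
            field_simp; norm_num, div_pow, mul_pow, inv_pow]
          ring
        rw [hr]
        refine le_mul_of_one_le_right (by positivity) ?_
        rwa [one_le_div (by positivity)]
    _ = ∏ i ∈ Finset.range n, 4 / (5 * n * (1 - q)) * ((i + 1 : ℕ) : ℝ) := by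
        rw [Finset.prod_mul_distrib, Finset.prod_const, Finset.card_range, ← Nat.cast_prod,
          Finset.prod_range_add_one_eq_factorial]
    _ ≤ _ := by
        refine Finset.prod_le_prod (fun i _ => by positivity) fun i hi => ?_
        exact geom_sum_ge hq hn hqn (Finset.mem_range.1 hi)

/-- There are absolute constants `C, c > 0` so that for `n≥1`,
`1/2 ≤ q ≤ 1−4/n` and integer `2 ≤ L < c/√(1−q)`, if `π ~ μ_{n,q}` then
`P(LDS(π) < L) ≤ (C(1−q)L²)^{n/L}`. -/
theorem mallows_LDS_lower_tail_upper_bound :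
    ∃ C c : ℝ, 0 < C ∧ 0 < c ∧
      ∀ (n : ℕ) (q : ℝ) (L : ℕ), 1 ≤ n → 1 / 2 ≤ q → q ≤ 1 - 4 / (n : ℝ) →
        2 ≤ L → (L : ℝ) < c / Real.sqrt (1 - q) →
        mallowsProb n q {π | LDS π < L} ≤
          (C * (1 - q) * (L : ℝ) ^ 2) ^ ((n : ℝ) / (L : ℝ)) := by
  classical
  refine ⟨4, 1 / 2, by norm_num, by norm_num, fun n q L hn hq hqn hL hLc => ?_⟩
  have hn0 : (0 : ℝ) < n := by exact_mod_cast hn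
  have hL0 : (2 : ℝ) ≤ L := by exact_mod_cast hL
  have hε : 0 < 1 - q := lt_of_lt_of_le (div_pos (by norm_num) hn0)
    (by linarith : 4 / (n : ℝ) ≤ 1 - q)
  have hq0 : 0 ≤ q := by linarith
  have hZ := inv_pow_le_sum_pow_mallowsInv hq0 hn hqn
  have hbase : 4 * (1 - q) * (L : ℝ) ^ 2 ≤ 1 := by
    rw [lt_div_iff₀ (Real.sqrt_pos.2 hε)] at hLc
    have h := mul_self_le_mul_self (by positivity) hLc.le
    have hs := Real.mul_self_sqrt hε.le
    have : L * √(1 - q) * (L * √(1 - q)) = (1 - q) * (L : ℝ) ^ 2 := by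
      linear_combination (L : ℝ) ^ 2 * hs
    linarith
  have hprob : mallowsProb n q {π | LDS π < L} ≤ (4 * (1 - q) * (L : ℝ) ^ 2) ^ n := by
    have hpmf : ∀ π : Equiv.Perm (Fin n), mallowsPMF n q π ≤ (4 * (1 - q)) ^ n := by
      intro π
      calc mallowsPMF n q π ≤ 1 / ((4 * (1 - q)) ^ n)⁻¹ :=
            div_le_div₀ zero_le_one (pow_le_one₀ hq0 (by linarith)) (by positivity) hZ
        _ = _ := by simp
    calc mallowsProb n q {π | LDS π < L}
        = ∑ π ∈ Finset.univ.filter (fun π : Equiv.Perm (Fin n) => LDS π < L),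
            mallowsPMF n q π := by
          rw [mallowsProb, Finset.sum_filter]
          simp [Set.indicator_apply]
      _ ≤ (Finset.univ.filter (fun π : Equiv.Perm (Fin n) => LDS π < L)).card •
            (4 * (1 - q)) ^ n := Finset.sum_le_card_nsmul _ _ _ fun π _ => hpmf π
      _ ≤ ((L ^ n * L ^ n : ℕ) : ℝ) * (4 * (1 - q)) ^ n := by
          rw [nsmul_eq_mul]
          gcongr
          exact card_LDS_lt_le n L
      _ = _ := by
          push_cast
          rw [← mul_pow, ← mul_pow]
          ring
  refine hprob.trans ?_
  rw [← Real.rpow_natCast]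
  refine Real.rpow_le_rpow_of_exponent_ge (by positivity) hbase ?_
  exact div_le_self hn0.le (by linarith)
end

section
/- Let n≥1 be an integer and 0 < q < ∞. If π is distributed according to the (n,q)-Mallows measure, then Var(LIS(π)) ≤ n−1, and moreover, for every real t > 0, P(|LIS(π) − E(LIS(π))| > t·√(n−1)) < 2·e^{−t²/2}. -/
open Finset

namespace Mallows

open Equiv

/-! ### Inserting a first value into a permutation -/

/-- The permutation of `Fin (n + 1)` whose first value is `p` and whose remaining values are
ordered as those of `σ`. -/
def insertFirst {n : ℕ} (p : Fin (n + 1)) (σ : Perm (Fin n)) : Perm (Fin (n + 1)) :=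
  ((finSuccEquiv' 0).trans (optionCongr σ)).trans (finSuccEquiv' p).symm

@[simp] lemma insertFirst_zero {n : ℕ} (p : Fin (n + 1)) (σ : Perm (Fin n)) :
    insertFirst p σ 0 = p := by
  simp [insertFirst]

@[simp] lemma insertFirst_succ {n : ℕ} (p : Fin (n + 1)) (σ : Perm (Fin n)) (i : Fin n) :
    insertFirst p σ i.succ = p.succAbove (σ i) := by
  have h : finSuccEquiv' 0 i.succ = some i := by
    rw [← Fin.succAbove_zero_apply, finSuccEquiv'_succAbove]
  simp [insertFirst, h]

lemma val_succAbove {n : ℕ} (p : Fin (n + 1)) (v : Fin n) :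
    (p.succAbove v : ℕ) = if (v : ℕ) < p then (v : ℕ) else v + 1 := by
  rw [Fin.succAbove]
  split_ifs with h₁ h₂ h₂ <;> simp_all [Fin.lt_def]

lemma insertFirst_bijective (n : ℕ) :
    Function.Bijective (fun x : Fin (n + 1) × Perm (Fin n) => insertFirst x.1 x.2) := by
  rw [Fintype.bijective_iff_injective_and_card]
  constructor
  · rintro ⟨p, σ⟩ ⟨p', σ'⟩ h
    have hp : p = p' := by simpa using congrArg (fun π => π 0) h
    subst hp
    have hσ : σ = σ' := by
      ext i : 1
      simpa using congrArg (fun π => π i.succ) h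
    rw [hσ]
  · simp [Fintype.card_perm, Nat.factorial_succ]

lemma sum_perm_succ {n : ℕ} (g : Perm (Fin (n + 1)) → ℝ) :
    ∑ π, g π = ∑ p, ∑ σ, g (insertFirst p σ) := by
  rw [← Fintype.sum_prod_type' (f := fun p σ => g (insertFirst p σ))]
  exact ((insertFirst_bijective n).sum_comp g).symm

lemma card_succAbove_lt {n : ℕ} (p : Fin (n + 1)) :
    (univ.filter fun v : Fin n => p.succAbove v < p).card = p := by
  have h : (univ.filter fun v : Fin n => p.succAbove v < p).map Fin.valEmbedding
      = range p := by
    ext x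
    simp only [Finset.mem_map, Finset.mem_filter, Finset.mem_univ, true_and, Finset.mem_range,
      Fin.valEmbedding_apply, Fin.lt_def, val_succAbove]
    constructor
    · rintro ⟨v, hv, rfl⟩
      split_ifs at hv <;> omega
    · intro hx
      exact ⟨⟨x, by omega⟩, by simp [hx], rfl⟩
  rw [← card_map, h, card_range]

lemma mallowsInv_insertFirst {n : ℕ} (p : Fin (n + 1)) (σ : Perm (Fin n)) :
    mallowsInv (insertFirst p σ) = p + mallowsInv σ := by
  have h : (∑ j : Fin n, if p.succAbove (σ j) < p then 1 else 0) = (p : ℕ) := by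
    rw [Equiv.sum_comp σ (fun v => if p.succAbove v < p then 1 else 0), ← card_filter,
      card_succAbove_lt]
  simp only [mallowsInv, card_filter, Fintype.sum_prod_type, Fin.sum_univ_succ]
  simp [h, (Fin.strictMono_succAbove p).lt_iff_lt]

/-! ### The Mallows measure -/

/-- The law of the first value under the Mallows measure on `S_{n+1}`. -/
noncomputable def firstWeight (n : ℕ) (q : ℝ) (p : Fin (n + 1)) : ℝ :=
  q ^ (p : ℕ) / ∑ p' : Fin (n + 1), q ^ (p' : ℕ)

section

variable {q : ℝ}

lemma firstWeight_nonneg (hq : 0 < q) {n : ℕ} (p : Fin (n + 1)) : 0 ≤ firstWeight n q p := by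
  unfold firstWeight
  positivity

lemma sum_firstWeight (hq : 0 < q) (n : ℕ) : ∑ p, firstWeight n q p = 1 := by
  simp only [firstWeight, ← Finset.sum_div]
  exact div_self (Finset.sum_pos (fun _ _ => by positivity) univ_nonempty).ne'

lemma mallowsPMF_nonneg (hq : 0 < q) {n : ℕ} (π : Perm (Fin n)) : 0 ≤ mallowsPMF n q π := by
  unfold mallowsPMF
  positivity

lemma sum_mallowsPMF (hq : 0 < q) (n : ℕ) : ∑ π, mallowsPMF n q π = 1 := by
  simp only [mallowsPMF, ← Finset.sum_div]
  exact div_self (Finset.sum_pos (fun _ _ => by positivity) univ_nonempty).ne'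

lemma mallowsPMF_insertFirst {n : ℕ} (p : Fin (n + 1)) (σ : Perm (Fin n)) :
    mallowsPMF (n + 1) q (insertFirst p σ) = firstWeight n q p * mallowsPMF n q σ := by
  simp only [mallowsPMF, firstWeight]
  rw [sum_perm_succ]
  simp only [mallowsInv_insertFirst, pow_add, ← Finset.mul_sum, ← Finset.sum_mul]
  rw [div_mul_div_comm]

lemma mallowsExp_succ {n : ℕ} (f : Perm (Fin (n + 1)) → ℝ) :
    mallowsExp (n + 1) q f
      = mallowsExp n q (fun σ => ∑ p, firstWeight n q p * f (insertFirst p σ)) := by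
  unfold mallowsExp
  rw [sum_perm_succ, Finset.sum_comm]
  refine Finset.sum_congr rfl fun σ _ => ?_
  rw [Finset.mul_sum]
  refine Finset.sum_congr rfl fun p _ => ?_
  rw [mallowsPMF_insertFirst]
  ring

lemma mallowsExp_mono (hq : 0 < q) {n : ℕ} {f g : Perm (Fin n) → ℝ} (h : ∀ π, f π ≤ g π) :
    mallowsExp n q f ≤ mallowsExp n q g :=
  Finset.sum_le_sum fun π _ => mul_le_mul_of_nonneg_left (h π) (mallowsPMF_nonneg hq π)

lemma mallowsExp_add {n : ℕ} (f g : Perm (Fin n) → ℝ) :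
    mallowsExp n q (fun π => f π + g π) = mallowsExp n q f + mallowsExp n q g := by
  simp [mallowsExp, mul_add, Finset.sum_add_distrib]

lemma mallowsExp_const_mul {n : ℕ} (c : ℝ) (f : Perm (Fin n) → ℝ) :
    mallowsExp n q (fun π => c * f π) = c * mallowsExp n q f := by
  simp only [mallowsExp, Finset.mul_sum]
  exact Finset.sum_congr rfl fun _ _ => by ring

lemma mallowsExp_const (hq : 0 < q) (n : ℕ) (c : ℝ) : mallowsExp n q (fun _ => c) = c := by
  simp [mallowsExp, ← Finset.sum_mul, sum_mallowsPMF hq]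

lemma mallowsExp_one (hq : 0 < q) (f : Perm (Fin 1) → ℝ) : mallowsExp 1 q f = f 1 := by
  have h : f = fun _ => f 1 := funext fun π => congrArg f (Subsingleton.elim π 1)
  rw [h, mallowsExp_const hq]

end

/-! ### Bounded differences -/

/-- `f` varies by at most `1` when one of the insertion positions that build up a permutation is
changed. -/
def BoundedDifferences : (n : ℕ) → (Perm (Fin n) → ℝ) → Prop
  | 0, _ => True
  | n + 1, f => (∀ p p' σ, |f (insertFirst p σ) - f (insertFirst p' σ)| ≤ 1) ∧
      ∀ p, BoundedDifferences n (fun σ => f (insertFirst p σ))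

lemma abs_sum_mul_le {ι : Type*} [Fintype ι] {w x : ι → ℝ} (hw : ∀ i, 0 ≤ w i)
    (h1 : ∑ i, w i = 1) (hx : ∀ i, |x i| ≤ 1) : |∑ i, w i * x i| ≤ 1 := by
  calc |∑ i, w i * x i| ≤ ∑ i, |w i * x i| := Finset.abs_sum_le_sum_abs _ _
    _ ≤ ∑ i, w i := Finset.sum_le_sum fun i _ => by
        rw [abs_mul, abs_of_nonneg (hw i)]
        exact mul_le_of_le_one_right (hw i) (hx i)
    _ = 1 := h1

lemma BoundedDifferences.weighted_sum {ι : Type*} [Fintype ι] {w : ι → ℝ}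
    (hw : ∀ i, 0 ≤ w i) (h1 : ∑ i, w i = 1) : ∀ {n : ℕ} {f : ι → Perm (Fin n) → ℝ},
    (∀ i, BoundedDifferences n (f i)) → BoundedDifferences n (fun σ => ∑ i, w i * f i σ)
  | 0, _, _ => trivial
  | n + 1, f, h => by
    refine ⟨fun p p' σ => ?_, fun p => weighted_sum hw h1 fun i => (h i).2 p⟩
    rw [← Finset.sum_sub_distrib]
    simp only [← mul_sub]
    exact abs_sum_mul_le hw h1 fun i => (h i).1 p p' σ

lemma abs_sub_weighted_sum_le {ι : Type*} [Fintype ι] {w x : ι → ℝ} (hw : ∀ i, 0 ≤ w i)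
    (h1 : ∑ i, w i = 1) (hx : ∀ i j, |x i - x j| ≤ 1) (i : ι) :
    |x i - ∑ j, w j * x j| ≤ 1 := by
  have h : x i - ∑ j, w j * x j = ∑ j, w j * (x i - x j) := by
    simp [mul_sub, ← Finset.sum_mul, h1]
  rw [h]
  exact abs_sum_mul_le hw h1 (hx i)

lemma weighted_sum_sq_le {ι : Type*} [Fintype ι] {w x : ι → ℝ} (hw : ∀ i, 0 ≤ w i)
    (h1 : ∑ i, w i = 1) (hx : ∀ i j, |x i - x j| ≤ 1) (c : ℝ) :
    ∑ i, w i * (x i - c) ^ 2 ≤ 1 + (∑ i, w i * x i - c) ^ 2 := by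
  set g := ∑ i, w i * x i with hg
  have hle : ∀ i, w i * (x i - c) ^ 2
      ≤ w i * (1 + (g - c) ^ 2 - 2 * (g - c) * g) + (w i * x i) * (2 * (g - c)) := fun i => by
    have := (sq_le_one_iff_abs_le_one _).2 (abs_sub_weighted_sum_le hw h1 hx i)
    rw [← hg] at this
    nlinarith [mul_le_mul_of_nonneg_left this (hw i)]
  calc _ ≤ _ := Finset.sum_le_sum fun i _ => hle i
    _ = _ := by
      rw [Finset.sum_add_distrib, ← Finset.sum_mul, ← Finset.sum_mul, h1, ← hg]
      ring

lemma exp_mul_le_cosh_add {z : ℝ} (hz : |z| ≤ 1) (r : ℝ) :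
    Real.exp (r * z) ≤ Real.cosh r + z * Real.sinh r := by
  obtain ⟨h₁, h₂⟩ := abs_le.1 hz
  have h := convexOn_exp.2 (Set.mem_univ r) (Set.mem_univ (-r))
    (show 0 ≤ (1 + z) / 2 by linarith) (show 0 ≤ (1 - z) / 2 by linarith) (by ring)
  simp only [smul_eq_mul] at h
  rw [show (1 + z) / 2 * r + (1 - z) / 2 * -r = r * z by ring] at h
  rw [Real.cosh_eq, Real.sinh_eq]
  linarith

lemma weighted_sum_exp_le {ι : Type*} [Fintype ι] {w x : ι → ℝ} (hw : ∀ i, 0 ≤ w i)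
    (h1 : ∑ i, w i = 1) (hx : ∀ i j, |x i - x j| ≤ 1) (r c : ℝ) :
    ∑ i, w i * Real.exp (r * (x i - c))
      ≤ Real.cosh r * Real.exp (r * (∑ i, w i * x i - c)) := by
  set g := ∑ i, w i * x i with hg
  have hle : ∀ i, w i * Real.exp (r * (x i - c)) ≤
      (w i * (Real.cosh r - g * Real.sinh r) + (w i * x i) * Real.sinh r)
        * Real.exp (r * (g - c)) := fun i => by
    have := exp_mul_le_cosh_add (abs_sub_weighted_sum_le hw h1 hx i) r
    rw [← hg] at this
    rw [show r * (x i - c) = r * (x i - g) + r * (g - c) by ring, Real.exp_add, ← mul_assoc]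
    refine mul_le_mul_of_nonneg_right ?_ (Real.exp_pos _).le
    nlinarith [mul_le_mul_of_nonneg_left this (hw i)]
  calc _ ≤ _ := Finset.sum_le_sum fun i _ => hle i
    _ = _ := by
      rw [← Finset.sum_mul, Finset.sum_add_distrib, ← Finset.sum_mul, ← Finset.sum_mul, h1, ← hg]
      ring

section

variable {q : ℝ}

lemma BoundedDifferences.variance_le (hq : 0 < q) : ∀ {n : ℕ} {f : Perm (Fin (n + 1)) → ℝ},
    BoundedDifferences (n + 1) f →
      mallowsExp (n + 1) q (fun π => (f π - mallowsExp (n + 1) q f) ^ 2) ≤ n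
  | 0, f, _ => by simp [mallowsExp_one hq]
  | n + 1, f, h => by
    have hw := firstWeight_nonneg hq (n := n + 1)
    have h1 := sum_firstWeight hq (n + 1)
    have ih := variance_le hq (weighted_sum hw h1 h.2)
    rw [← mallowsExp_succ] at ih
    rw [mallowsExp_succ]
    refine (mallowsExp_mono hq fun σ =>
      weighted_sum_sq_le hw h1 (fun p p' => h.1 p p' σ) _).trans ?_
    rw [mallowsExp_add, mallowsExp_const hq]
    push_cast
    linarith

lemma BoundedDifferences.mgf_le (hq : 0 < q) (r : ℝ) :
    ∀ {n : ℕ} {f : Perm (Fin (n + 1)) → ℝ}, BoundedDifferences (n + 1) f →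
      mallowsExp (n + 1) q (fun π => Real.exp (r * (f π - mallowsExp (n + 1) q f)))
        ≤ Real.cosh r ^ n
  | 0, f, _ => by simp [mallowsExp_one hq]
  | n + 1, f, h => by
    have hw := firstWeight_nonneg hq (n := n + 1)
    have h1 := sum_firstWeight hq (n + 1)
    have ih := mgf_le hq r (weighted_sum hw h1 h.2)
    rw [← mallowsExp_succ] at ih
    rw [mallowsExp_succ]
    refine (mallowsExp_mono hq fun σ =>
      weighted_sum_exp_le hw h1 (fun p p' => h.1 p p' σ) r _).trans ?_
    rw [mallowsExp_const_mul, pow_succ']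
    exact mul_le_mul_of_nonneg_left ih (Real.cosh_pos r).le

lemma cosh_lt_exp_half_sq {r : ℝ} (hr : r ≠ 0) : Real.cosh r < Real.exp (r ^ 2 / 2) := by
  have h₁ := Real.cosh_le_exp_half_sq (r / 2)
  have h₂ := Real.cosh_pos (r / 2)
  have h₃ : Real.cosh r = 2 * Real.cosh (r / 2) ^ 2 - 1 := by
    have := Real.cosh_two_mul (r / 2)
    rw [Real.sinh_sq, mul_div_cancel₀ r two_ne_zero] at this
    linarith
  set x := Real.exp ((r / 2) ^ 2 / 2) with hx
  have h₄ : Real.exp (r ^ 2 / 2) = (x ^ 2) ^ 2 := by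
    rw [hx, ← pow_mul, ← Real.exp_nat_mul]
    congr 1
    push_cast
    ring
  have h₅ : 1 < x := Real.one_lt_exp_iff.2 (by positivity)
  have h₆ : Real.cosh (r / 2) ^ 2 ≤ x ^ 2 := by gcongr
  have h₇ : 1 < x ^ 2 := by nlinarith
  rw [h₃, h₄]
  nlinarith

lemma mallowsProb_eq_mallowsExp {n : ℕ} (A : Set (Perm (Fin n))) :
    mallowsProb n q A = mallowsExp n q (A.indicator fun _ => 1) := by
  classical
  simp [mallowsProb, mallowsExp, Set.indicator_apply]

lemma BoundedDifferences.tail_lt (hq : 0 < q) {n : ℕ} {f : Perm (Fin (n + 1)) → ℝ}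
    (h : BoundedDifferences (n + 1) f) {t : ℝ} (ht : 0 < t) :
    mallowsProb (n + 1) q
        {π | t * Real.sqrt n < |f π - mallowsExp (n + 1) q f|} < 2 * Real.exp (-t ^ 2 / 2) := by
  rcases Nat.eq_zero_or_pos n with rfl | hn
  · simp only [mallowsProb_eq_mallowsExp, mallowsExp_one hq]
    simp [Real.exp_pos]
  set s := Real.sqrt n with hs
  have hn' : (0 : ℝ) < n := by exact_mod_cast hn
  have hs0 : 0 < s := Real.sqrt_pos.2 hn'
  have hs2 : s ^ 2 = n := Real.sq_sqrt hn'.le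
  set m := mallowsExp (n + 1) q f with hm
  set r := t / s with hr
  have hr0 : 0 < r := by positivity
  have hrs : r * (t * s) = t ^ 2 := by
    rw [hr]
    field_simp
  have hcosh : Real.cosh r ^ n < Real.exp (t ^ 2 / 2) := by
    calc Real.cosh r ^ n < Real.exp (r ^ 2 / 2) ^ n :=
          pow_lt_pow_left₀ (cosh_lt_exp_half_sq hr0.ne') (Real.cosh_pos r).le hn.ne'
      _ = Real.exp (t ^ 2 / 2) := by
          rw [← Real.exp_nat_mul, ← hs2, hr]
          congr 1
          field_simp
  have hpt : ∀ π, {π | t * s < |f π - m|}.indicator (fun _ => (1 : ℝ)) π ≤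
      Real.exp (-t ^ 2) *
        (Real.exp (r * (f π - m)) + Real.exp (-r * (f π - m))) := fun π => by
    refine Set.indicator_le' (f := fun _ => (1 : ℝ)) (g := fun π => Real.exp (-t ^ 2) *
        (Real.exp (r * (f π - m)) + Real.exp (-r * (f π - m)))) (fun π hπ => ?_)
        (fun π _ => by positivity) π
    have hπ' : t ^ 2 ≤ r * |f π - m| := by
      rw [← hrs]
      exact mul_le_mul_of_nonneg_left (le_of_lt hπ) hr0.le
    rw [mul_add, ← Real.exp_add, ← Real.exp_add]
    rcases abs_cases (f π - m) with ⟨ha, _⟩ | ⟨ha, _⟩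
    · have : 1 ≤ Real.exp (-t ^ 2 + r * (f π - m)) :=
        Real.one_le_exp (by rw [ha] at hπ'; linarith)
      linarith [Real.exp_pos (-t ^ 2 + -r * (f π - m))]
    · have : 1 ≤ Real.exp (-t ^ 2 + -r * (f π - m)) :=
        Real.one_le_exp (by rw [ha] at hπ'; linarith)
      linarith [Real.exp_pos (-t ^ 2 + r * (f π - m))]
  have h₁ := h.mgf_le hq r
  have h₂ := h.mgf_le hq (-r)
  rw [Real.cosh_neg] at h₂
  rw [mallowsProb_eq_mallowsExp]
  calc _ ≤ _ := mallowsExp_mono hq hpt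
    _ ≤ Real.exp (-t ^ 2) * (2 * Real.cosh r ^ n) := by
        rw [mallowsExp_const_mul, mallowsExp_add]
        exact mul_le_mul_of_nonneg_left (by linarith) (Real.exp_pos _).le
    _ < Real.exp (-t ^ 2) * (2 * Real.exp (t ^ 2 / 2)) := by
        have := Real.exp_pos (-t ^ 2)
        gcongr
    _ = 2 * Real.exp (-t ^ 2 / 2) := by
        rw [mul_left_comm, ← Real.exp_add]
        congr 2
        ring

end

/-! ### Longest increasing subsequences above a level -/

/-- `s` is the set of positions of an increasing subsequence of `π` with values at least `k`. -/
def IsIncreasingAbove {n : ℕ} (π : Perm (Fin n)) (k : ℕ) (s : Finset (Fin n)) : Prop :=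
  StrictMonoOn π s ∧ ∀ i ∈ s, k ≤ (π i : ℕ)

open Classical in
/-- The maximal length of an increasing subsequence of `π` with values at least `k`. -/
noncomputable def lisAbove {n : ℕ} (π : Perm (Fin n)) (k : ℕ) : ℕ :=
  (univ.filter (IsIncreasingAbove π k)).sup card

section

variable {n : ℕ}

lemma IsIncreasingAbove.card_le {π : Perm (Fin n)} {k : ℕ} {s : Finset (Fin n)}
    (hs : IsIncreasingAbove π k s) : s.card ≤ lisAbove π k := by
  classical
  exact le_sup (f := card) (by simpa using hs)

lemma exists_card_eq_lisAbove (π : Perm (Fin n)) (k : ℕ) :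
    ∃ s, IsIncreasingAbove π k s ∧ s.card = lisAbove π k := by
  classical
  obtain ⟨s, hs, h⟩ := exists_mem_eq_sup (univ.filter (IsIncreasingAbove π k))
    ⟨∅, by simp [IsIncreasingAbove, StrictMonoOn]⟩ card
  exact ⟨s, by simpa using hs, h.symm⟩

lemma lisAbove_antitone (π : Perm (Fin n)) : Antitone (lisAbove π) := fun k l hkl => by
  obtain ⟨s, hs, h⟩ := exists_card_eq_lisAbove π l
  rw [← h]
  exact IsIncreasingAbove.card_le ⟨hs.1, fun i hi => hkl.trans (hs.2 i hi)⟩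

lemma lisAbove_le_succ (π : Perm (Fin n)) (k : ℕ) : lisAbove π k ≤ lisAbove π (k + 1) + 1 := by
  obtain ⟨s, hs, h⟩ := exists_card_eq_lisAbove π k
  rw [← h]
  by_cases hk : ∃ i ∈ s, (π i : ℕ) = k
  · obtain ⟨i, hi, hik⟩ := hk
    rw [← card_erase_add_one hi]
    refine Nat.succ_le_succ (IsIncreasingAbove.card_le
      ⟨hs.1.mono (by simp), fun j hj => ?_⟩)
    have hj' := mem_erase.1 hj
    refine lt_of_le_of_ne (hs.2 j hj'.2) fun hne => hj'.1 ?_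
    exact π.injective (Fin.ext (hne.symm.trans hik.symm))
  · push Not at hk
    exact (IsIncreasingAbove.card_le (k := k + 1)
      ⟨hs.1, fun i hi => lt_of_le_of_ne (hs.2 i hi) (hk i hi).symm⟩).trans (Nat.le_succ _)

lemma LIS_eq_lisAbove (π : Perm (Fin n)) : LIS π = lisAbove π 0 := by
  refine IsGreatest.csSup_eq ⟨?_, ?_⟩
  · obtain ⟨s, hs, h⟩ := exists_card_eq_lisAbove π 0
    refine ⟨s.orderEmbOfFin h, (s.orderEmbOfFin h).strictMono, fun i j hij => ?_⟩
    exact hs.1 (s.orderEmbOfFin_mem h i) (s.orderEmbOfFin_mem h j)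
      ((s.orderEmbOfFin h).strictMono hij)
  · rintro m ⟨f, hf, hπ⟩
    have hs : IsIncreasingAbove π 0 (univ.map ⟨f, hf.injective⟩) := by
      refine ⟨?_, by simp⟩
      intro x hx y hy hxy
      simp only [coe_map, Function.Embedding.coeFn_mk, coe_univ, Set.image_univ,
        Set.mem_range] at hx hy
      obtain ⟨i, rfl⟩ := hx
      obtain ⟨j, rfl⟩ := hy
      exact hπ (hf.lt_iff_lt.1 hxy)
    simpa using hs.card_le

/-! #### Behaviour under insertion of a first value -/

variable (p : Fin (n + 1)) (σ : Perm (Fin n))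

lemma strictMonoOn_map_succ {t : Finset (Fin n)} (ht : StrictMonoOn σ t) :
    StrictMonoOn (insertFirst p σ) (t.map (Fin.succEmb n) : Finset (Fin (n + 1))) := by
  intro x hx y hy hxy
  simp only [coe_map, Fin.coe_succEmb, Set.mem_image, mem_coe] at hx hy
  obtain ⟨i, hi, rfl⟩ := hx
  obtain ⟨j, hj, rfl⟩ := hy
  simpa using ht hi hj (Fin.succ_lt_succ_iff.1 hxy)

lemma isIncreasingAbove_map_succ {k l : ℕ} {t : Finset (Fin n)}
    (ht : IsIncreasingAbove σ k t)
    (hkl : ∀ i ∈ t, k ≤ (σ i : ℕ) → l ≤ (p.succAbove (σ i) : ℕ)) :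
    IsIncreasingAbove (insertFirst p σ) l (t.map (Fin.succEmb n)) := by
  refine ⟨strictMonoOn_map_succ p σ ht.1, fun x hx => ?_⟩
  obtain ⟨i, hi, rfl⟩ := Finset.mem_map.1 hx
  simpa using hkl i hi (ht.2 i hi)

lemma isIncreasingAbove_insert_zero {t : Finset (Fin n)} (ht : IsIncreasingAbove σ p t) :
    IsIncreasingAbove (insertFirst p σ) p (insert 0 (t.map (Fin.succEmb n))) := by
  have hlt : ∀ i ∈ t, p < p.succAbove (σ i) := fun i hi => by
    have := ht.2 i hi
    rw [Fin.lt_def, val_succAbove]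
    split_ifs <;> omega
  have hm := strictMonoOn_map_succ p σ ht.1
  refine ⟨?_, fun x hx => ?_⟩
  · intro x hx y hy hxy
    rw [mem_coe, mem_insert] at hx hy
    rcases hy with rfl | hy
    · exact absurd hxy (Fin.not_lt_zero x)
    rcases hx with rfl | hx
    · obtain ⟨i, hi, rfl⟩ := Finset.mem_map.1 hy
      simpa using hlt i hi
    · exact hm hx hy hxy
  · rcases mem_insert.1 hx with rfl | hx
    · simp
    · obtain ⟨i, hi, rfl⟩ := Finset.mem_map.1 hx
      simpa using (Fin.lt_def.1 (hlt i hi)).le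

lemma exists_isIncreasingAbove_of_insertFirst {k l : ℕ} {s : Finset (Fin (n + 1))}
    (hs : IsIncreasingAbove (insertFirst p σ) k s)
    (hkl : ∀ i : Fin n, i.succ ∈ s → k ≤ (p.succAbove (σ i) : ℕ) → l ≤ (σ i : ℕ)) :
    (s.erase 0).card ≤ lisAbove σ l := by
  have he : s.erase 0 = (univ.filter fun i : Fin n => i.succ ∈ s).map (Fin.succEmb n) := by
    ext x
    refine Fin.cases (by simp) (fun i => ?_) x
    simp
  rw [he, card_map]
  refine IsIncreasingAbove.card_le ⟨fun i hi j hj hij => ?_, fun i hi => ?_⟩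
  · have := hs.1 (by simpa using hi) (by simpa using hj) (Fin.succ_lt_succ_iff.2 hij)
    simpa using this
  · have hi' : i.succ ∈ s := by simpa using hi
    exact hkl i hi' (by simpa using hs.2 _ hi')

lemma lisAbove_insertFirst_of_le {k : ℕ} (hk : k ≤ p) :
    lisAbove (insertFirst p σ) k = max (lisAbove σ k) (lisAbove σ p + 1) := by
  apply le_antisymm
  · obtain ⟨s, hs, h⟩ := exists_card_eq_lisAbove (insertFirst p σ) k
    rw [← h]
    by_cases h0 : 0 ∈ s
    · rw [← card_erase_add_one h0]
      refine le_max_of_le_right (Nat.succ_le_succ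
        (exists_isIncreasingAbove_of_insertFirst p σ hs fun i hi _ => ?_))
      have := hs.1 h0 hi (Fin.succ_pos i)
      simp only [insertFirst_zero, insertFirst_succ, Fin.lt_def, val_succAbove] at this
      split_ifs at this <;> omega
    · rw [← erase_eq_of_notMem h0]
      refine le_max_of_le_left
        (exists_isIncreasingAbove_of_insertFirst p σ hs fun i _ hi => ?_)
      rw [val_succAbove] at hi
      split_ifs at hi <;> omega
  · refine max_le ?_ ?_
    · obtain ⟨t, ht, h⟩ := exists_card_eq_lisAbove σ k
      rw [← h, ← card_map (Fin.succEmb n)]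
      refine (isIncreasingAbove_map_succ p σ ht fun i _ hi => ?_).card_le
      rw [val_succAbove]
      split_ifs <;> omega
    · obtain ⟨t, ht, h⟩ := exists_card_eq_lisAbove σ p
      rw [← h, ← card_map (Fin.succEmb n), ← card_insert_of_notMem (a := 0) (by simp)]
      exact (isIncreasingAbove_insert_zero p σ ht).card_le.trans (lisAbove_antitone _ hk)

lemma lisAbove_insertFirst_succ {k : ℕ} (hk : p ≤ k) :
    lisAbove (insertFirst p σ) (k + 1) = lisAbove σ k := by
  apply le_antisymm
  · obtain ⟨s, hs, h⟩ := exists_card_eq_lisAbove (insertFirst p σ) (k + 1)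
    have h0 : 0 ∉ s := fun h0 => by
      have := hs.2 0 h0
      rw [insertFirst_zero] at this
      omega
    rw [← h, ← erase_eq_of_notMem h0]
    refine exists_isIncreasingAbove_of_insertFirst p σ hs fun i _ hi => ?_
    rw [val_succAbove] at hi
    split_ifs at hi <;> omega
  · obtain ⟨t, ht, h⟩ := exists_card_eq_lisAbove σ k
    rw [← h, ← card_map (Fin.succEmb n)]
    refine (isIncreasingAbove_map_succ p σ ht fun i _ hi => ?_).card_le
    rw [val_succAbove]
    split_ifs <;> omega

end

/-! ### Completing a prefix by a permutation -/

/-- The longest increasing subsequence of a sequence consisting of a prefix followed by `π`, where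
`a k` is the longest increasing subsequence of the prefix staying below all values `≥ k` of `π`. -/
noncomputable def lisWithPrefix {n : ℕ} (a : ℕ → ℕ) (π : Perm (Fin n)) : ℕ :=
  (range (n + 1)).sup fun k => a k + lisAbove π k

/-- The profile of a prefix with profile `a` after the value `p` has been appended to it. -/
def appendProfile (a : ℕ → ℕ) (p j : ℕ) : ℕ :=
  if j < p then a j else max (a (j + 1)) (a p + 1)

section

variable {n : ℕ} {a : ℕ → ℕ}

lemma le_lisWithPrefix (a : ℕ → ℕ) (π : Perm (Fin n)) {k : ℕ} (hk : k ≤ n) :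
    a k + lisAbove π k ≤ lisWithPrefix a π :=
  le_sup (f := fun k => a k + lisAbove π k) (mem_range.2 (Nat.lt_succ_of_le hk))

lemma lisWithPrefix_le {π : Perm (Fin n)} {B : ℕ} (h : ∀ k ≤ n, a k + lisAbove π k ≤ B) :
    lisWithPrefix a π ≤ B :=
  Finset.sup_le fun k hk => h k (Nat.lt_succ_iff.1 (mem_range.1 hk))

lemma LIS_eq_lisWithPrefix (π : Perm (Fin n)) : LIS π = lisWithPrefix (fun _ => 0) π := by
  rw [LIS_eq_lisAbove]
  apply le_antisymm
  · simpa using le_lisWithPrefix (fun _ => 0) π (Nat.zero_le n)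
  · exact lisWithPrefix_le fun k _ => by simpa using lisAbove_antitone π (Nat.zero_le k)

lemma appendProfile_monotone (ha : Monotone a) (p : ℕ) : Monotone (appendProfile a p) := by
  refine monotone_nat_of_le_succ fun j => ?_
  have h₁ : a j ≤ a (j + 1) := ha (Nat.le_succ j)
  have h₂ : a (j + 1) ≤ a (j + 1 + 1) := ha (Nat.le_succ (j + 1))
  unfold appendProfile
  split_ifs <;> omega

lemma lisWithPrefix_insertFirst (ha : Monotone a) (p : Fin (n + 1)) (σ : Perm (Fin n)) :
    lisWithPrefix a (insertFirst p σ) = lisWithPrefix (appendProfile a p) σ := by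
  have hp : (p : ℕ) ≤ n := Nat.lt_succ_iff.1 p.2
  have hlt : ∀ j < (p : ℕ), appendProfile a p j = a j := fun j hj => if_pos hj
  have hge : ∀ j ≥ (p : ℕ), appendProfile a p j = max (a (j + 1)) (a p + 1) :=
    fun j hj => if_neg hj.not_gt
  apply le_antisymm
  · refine lisWithPrefix_le fun k hk => ?_
    rcases le_or_gt k p with hkp | hkp
    · rw [lisAbove_insertFirst_of_le p σ hkp]
      have h₁ := le_lisWithPrefix (appendProfile a p) σ (hkp.trans hp)
      have h₂ := le_lisWithPrefix (appendProfile a p) σ hp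
      have h₃ := ha hkp
      rw [hge p le_rfl] at h₂
      have h₄ : a k ≤ appendProfile a p k := by
        unfold appendProfile
        split_ifs <;> [exact le_rfl; exact le_max_of_le_left (ha k.le_succ)]
      omega
    · obtain ⟨j, rfl⟩ := Nat.exists_eq_add_one_of_ne_zero (Nat.ne_zero_of_lt hkp)
      have hj : (p : ℕ) ≤ j := Nat.lt_succ_iff.1 hkp
      rw [lisAbove_insertFirst_succ p σ hj]
      have h₁ := le_lisWithPrefix (appendProfile a p) σ (Nat.succ_le_succ_iff.1 hk)
      rw [hge j hj] at h₁
      omega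
  · refine lisWithPrefix_le fun j hj => ?_
    rcases lt_or_ge j p with h | h
    · have h₁ := le_lisWithPrefix a (insertFirst p σ) (Nat.le_succ_of_le hj)
      rw [lisAbove_insertFirst_of_le p σ h.le] at h₁
      rw [hlt j h]
      omega
    · have h₁ := le_lisWithPrefix a (insertFirst p σ) (Nat.le_succ_of_le hp)
      have h₂ := le_lisWithPrefix a (insertFirst p σ) (Nat.succ_le_succ hj)
      have h₃ := lisAbove_antitone σ h
      rw [lisAbove_insertFirst_of_le p σ le_rfl] at h₁
      rw [Nat.succ_eq_add_one, lisAbove_insertFirst_succ p σ h] at h₂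
      rw [hge j h]
      omega

lemma lisWithPrefix_appendProfile_le (ha : Monotone a) {p p' : ℕ} (hpp' : p < p')
    (σ : Perm (Fin n)) :
    lisWithPrefix (appendProfile a p') σ ≤ lisWithPrefix (appendProfile a p) σ + 1 := by
  refine lisWithPrefix_le fun j hj => ?_
  have h₁ := le_lisWithPrefix (appendProfile a p) σ hj
  have h₂ : appendProfile a p' j ≤ appendProfile a p j + 1 := by
    have h₃ : a j ≤ a (j + 1) := ha (Nat.le_succ j)
    have h₄ : p' ≤ j → a p' ≤ a j := fun h => ha h
    unfold appendProfile
    split_ifs <;> omega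
  omega

lemma lisWithPrefix_appendProfile_le' (ha : Monotone a) {p p' : ℕ} (hpp' : p < p')
    (hp' : p' ≤ n) (σ : Perm (Fin n)) :
    lisWithPrefix (appendProfile a p) σ ≤ lisWithPrefix (appendProfile a p') σ + 1 := by
  refine lisWithPrefix_le fun j hj => ?_
  have h₁ := le_lisWithPrefix (appendProfile a p') σ hj
  by_cases h : appendProfile a p j ≤ appendProfile a p' j + 1
  · omega
  · have h₂ : p ≤ j → a p ≤ a j := fun h => ha h
    have h₃ : a p ≤ a p' := ha hpp'.le
    have hjp' : j < p' := by
      by_contra hjp'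
      unfold appendProfile at h
      split_ifs at h <;> omega
    have h₄ := le_lisWithPrefix (appendProfile a p') σ (show j + 1 ≤ n by omega)
    have h₅ := lisAbove_le_succ σ j
    have h₆ : appendProfile a p j ≤ appendProfile a p' (j + 1) := by
      have h₇ : a (j + 1) ≤ a p' := ha hjp'
      unfold appendProfile at h ⊢
      split_ifs at h ⊢ <;> omega
    omega

end

lemma boundedDifferences_lisWithPrefix : ∀ (n : ℕ) {a : ℕ → ℕ}, Monotone a →
    BoundedDifferences n (fun π => (lisWithPrefix a π : ℝ))
  | 0, _, _ => trivial
  | n + 1, a, ha => by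
    refine ⟨fun p p' σ => ?_, fun p => ?_⟩
    · simp only [lisWithPrefix_insertFirst ha]
      have key : ∀ r r' : Fin (n + 1), r < r' →
          |(lisWithPrefix (appendProfile a r) σ : ℝ) - lisWithPrefix (appendProfile a r') σ|
            ≤ 1 := fun r r' h => by
        have h₁ : (_ : ℝ) ≤ _ := Nat.cast_le.2 (lisWithPrefix_appendProfile_le ha h σ)
        have h₂ : (_ : ℝ) ≤ _ := Nat.cast_le.2
          (lisWithPrefix_appendProfile_le' ha h (Nat.lt_succ_iff.1 r'.2) σ)
        push_cast at h₁ h₂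
        exact abs_le.2 ⟨by linarith, by linarith⟩
      rcases lt_trichotomy p p' with h | rfl | h
      · exact key p p' h
      · simp
      · rw [abs_sub_comm]
        exact key p' p h
    · simp only [lisWithPrefix_insertFirst ha]
      exact boundedDifferences_lisWithPrefix n (appendProfile_monotone ha p)

lemma boundedDifferences_LIS (n : ℕ) :
    BoundedDifferences n (fun π => (LIS π : ℝ)) := by
  simp only [LIS_eq_lisWithPrefix]
  exact boundedDifferences_lisWithPrefix n monotone_const

end Mallows

/-- For `n≥1` and `0<q<∞`, if `π ~ μ_{n,q}` then `Var(LIS(π)) ≤ n−1` and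
for every `t>0`, `P(|LIS(π) − E(LIS(π))| > t√(n−1)) < 2·e^{−t²/2}`. -/
theorem mallows_LIS_variance_and_concentration (n : ℕ) (hn : 1 ≤ n) (q : ℝ) (hq : 0 < q) :
    mallowsExp n q
        (fun π => ((LIS π : ℝ) - mallowsExp n q (fun σ => (LIS σ : ℝ))) ^ 2) ≤ (n : ℝ) - 1 ∧
    ∀ t : ℝ, 0 < t →
      mallowsProb n q
          {π | t * Real.sqrt ((n : ℝ) - 1) <
            |(LIS π : ℝ) - mallowsExp n q (fun σ => (LIS σ : ℝ))|} <
        2 * Real.exp (-t ^ 2 / 2) := by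
  obtain ⟨m, rfl⟩ := Nat.exists_eq_add_of_le' hn
  have h := Mallows.boundedDifferences_LIS (m + 1)
  have hm : ((m + 1 : ℕ) : ℝ) - 1 = m := by push_cast; ring
  rw [hm]
  exact ⟨h.variance_le hq, fun t ht => h.tail_lt hq ht⟩
end

section
/- Let n≥1 be an integer, q > 0, and let I = (i, i+1, …, i+m−1) ⊆ {1,…,n} be a sequence of m consecutive indices. If π is distributed according to the (n,q)-Mallows measure, then the induced relative ordering π_I is distributed according to the (m,q)-Mallows measure: for every ω ∈ S_m, P(π_I = ω) = μ_{m,q}({ω}). -/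
open Finset

/-- `ω` is the relative ordering that `π` induces on the indices in the range of `g`. -/
def InducesOrdering {m n : ℕ} (g : Fin m ↪o Fin n) (π : Equiv.Perm (Fin n))
    (ω : Equiv.Perm (Fin m)) : Prop :=
  ∀ j l : Fin m, ω l < ω j ↔ π (g l) < π (g j)

/-- The inversions of `π` between two indices that are not both in the range of `g`. -/
noncomputable def outerInv {m n : ℕ} (g : Fin m ↪o Fin n) (π : Equiv.Perm (Fin n)) :
    Finset (Fin n × Fin n) :=
  open Classical in
  Finset.univ.filter fun p => (p.1 < p.2 ∧ π p.2 < π p.1) ∧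
    ¬(p.1 ∈ Set.range g ∧ p.2 ∈ Set.range g)

theorem mem_outerInv {m n : ℕ} {g : Fin m ↪o Fin n} {π : Equiv.Perm (Fin n)}
    {p : Fin n × Fin n} : p ∈ outerInv g π ↔ (p.1 < p.2 ∧ π p.2 < π p.1) ∧
      ¬(p.1 ∈ Set.range g ∧ p.2 ∈ Set.range g) := by
  simp only [outerInv, Finset.mem_filter, Finset.mem_univ, true_and]

theorem viaFintypeEmbedding_mem_range_iff {m n : ℕ} (g : Fin m ↪o Fin n)
    (τ : Equiv.Perm (Fin m)) (x : Fin n) :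
    τ.viaFintypeEmbedding g.toEmbedding x ∈ Set.range g ↔ x ∈ Set.range g := by
  by_cases hx : x ∈ Set.range g
  · obtain ⟨y, rfl⟩ := hx
    have h := τ.viaFintypeEmbedding_apply_image g.toEmbedding y
    simp only [RelEmbedding.coe_toEmbedding] at h
    rw [h]
    simp
  · rw [τ.viaFintypeEmbedding_apply_notMem_range g.toEmbedding hx]

theorem viaFintypeEmbedding_lt {m n : ℕ} (g : Fin m ↪o Fin n)
    (hg : (Set.range g).OrdConnected) (τ : Equiv.Perm (Fin m)) {a b : Fin n} (hab : a < b)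
    (h : ¬(a ∈ Set.range g ∧ b ∈ Set.range g)) :
    τ.viaFintypeEmbedding g.toEmbedding a < τ.viaFintypeEmbedding g.toEmbedding b := by
  have key : ∀ x, x ∉ Set.range g → τ.viaFintypeEmbedding g.toEmbedding x = x :=
    fun x hx => τ.viaFintypeEmbedding_apply_notMem_range g.toEmbedding hx
  by_cases ha : a ∈ Set.range g
  · have hb : b ∉ Set.range g := fun hb => h ⟨ha, hb⟩
    rw [key b hb]
    by_contra! hle
    exact hb (hg.out ha ((viaFintypeEmbedding_mem_range_iff g τ a).2 ha) ⟨hab.le, hle⟩)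
  · rw [key a ha]
    by_cases hb : b ∈ Set.range g
    · by_contra! hle
      exact ha (hg.out ((viaFintypeEmbedding_mem_range_iff g τ b).2 hb) hb ⟨hle, hab.le⟩)
    · rwa [key b hb]

theorem card_outerInv_le {m n : ℕ} (g : Fin m ↪o Fin n)
    (hg : (Set.range g).OrdConnected) (τ : Equiv.Perm (Fin m)) (π : Equiv.Perm (Fin n)) :
    (outerInv g (π * τ.viaFintypeEmbedding g.toEmbedding)).card ≤ (outerInv g π).card := by
  set e := τ.viaFintypeEmbedding g.toEmbedding with he
  refine Finset.card_le_card_of_injOn (fun p => (e p.1, e p.2)) ?_ ?_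
  · intro p hp
    obtain ⟨⟨hlt, hinv⟩, hp⟩ := mem_outerInv.1 hp
    refine mem_outerInv.2 ⟨⟨viaFintypeEmbedding_lt g hg τ hlt hp, hinv⟩, ?_⟩
    simpa only [he, viaFintypeEmbedding_mem_range_iff] using hp
  · rintro ⟨a, b⟩ - ⟨c, d⟩ - h
    simpa using h

theorem viaFintypeEmbedding_mul_inv {m n : ℕ} (g : Fin m ↪o Fin n) (τ : Equiv.Perm (Fin m)) :
    τ.viaFintypeEmbedding g.toEmbedding * τ⁻¹.viaFintypeEmbedding g.toEmbedding = 1 := by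
  ext1 x
  by_cases hx : x ∈ Set.range g
  · obtain ⟨y, rfl⟩ := hx
    have h := fun σ : Equiv.Perm (Fin m) => σ.viaFintypeEmbedding_apply_image g.toEmbedding
    simp only [RelEmbedding.coe_toEmbedding] at h
    simp [h]
  · have key := fun σ : Equiv.Perm (Fin m) =>
      σ.viaFintypeEmbedding_apply_notMem_range g.toEmbedding hx
    simp [key]

theorem card_outerInv_mul {m n : ℕ} (g : Fin m ↪o Fin n)
    (hg : (Set.range g).OrdConnected) (τ : Equiv.Perm (Fin m)) (π : Equiv.Perm (Fin n)) :
    (outerInv g (π * τ.viaFintypeEmbedding g.toEmbedding)).card = (outerInv g π).card := by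
  refine (card_outerInv_le g hg τ π).antisymm ?_
  have h := card_outerInv_le g hg τ⁻¹ (π * τ.viaFintypeEmbedding g.toEmbedding)
  rwa [mul_assoc, viaFintypeEmbedding_mul_inv, mul_one] at h

theorem InducesOrdering.mallowsInv_eq {m n : ℕ} {g : Fin m ↪o Fin n} {π : Equiv.Perm (Fin n)}
    {ω : Equiv.Perm (Fin m)} (h : InducesOrdering g π ω) :
    mallowsInv π = mallowsInv ω + (outerInv g π).card := by
  classical
  have hinner : mallowsInv ω = ((Finset.univ.filter fun p : Fin n × Fin n =>
      p.1 < p.2 ∧ π p.2 < π p.1).filter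
        fun p => p.1 ∈ Set.range g ∧ p.2 ∈ Set.range g).card := by
    refine Finset.card_bij (fun p _ => (g p.1, g p.2)) ?_ ?_ ?_
    · intro p hp
      simp only [Finset.mem_filter, Finset.mem_univ, true_and] at hp ⊢
      exact ⟨⟨g.lt_iff_lt.2 hp.1, (h _ _).1 hp.2⟩, ⟨_, rfl⟩, ⟨_, rfl⟩⟩
    · rintro ⟨a, b⟩ - ⟨c, d⟩ - h
      simpa using h
    · rintro ⟨a, b⟩ hp
      simp only [Finset.mem_filter, Finset.mem_univ, true_and] at hp
      obtain ⟨⟨hlt, hinv⟩, ⟨c, rfl⟩, ⟨d, rfl⟩⟩ := hp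
      refine ⟨(c, d), ?_, rfl⟩
      simp only [Finset.mem_filter, Finset.mem_univ, true_and]
      exact ⟨g.lt_iff_lt.1 hlt, (h _ _).2 hinv⟩
  have houter : outerInv g π = (Finset.univ.filter fun p : Fin n × Fin n =>
      p.1 < p.2 ∧ π p.2 < π p.1).filter
        fun p => ¬(p.1 ∈ Set.range g ∧ p.2 ∈ Set.range g) := by
    ext p
    simp only [mem_outerInv, Finset.mem_filter, Finset.mem_univ, true_and]
  rw [hinner, houter, Finset.card_filter_add_card_filter_not]
  rfl

theorem inducesOrdering_mul_iff {m n : ℕ} (g : Fin m ↪o Fin n) (π : Equiv.Perm (Fin n))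
    (ω τ : Equiv.Perm (Fin m)) :
    InducesOrdering g (π * τ.viaFintypeEmbedding g.toEmbedding) (ω * τ) ↔
      InducesOrdering g π ω := by
  have h := τ.viaFintypeEmbedding_apply_image g.toEmbedding
  simp only [RelEmbedding.coe_toEmbedding] at h
  simp only [InducesOrdering, Equiv.Perm.mul_apply, h]
  exact ⟨fun H j l => by simpa using H (τ⁻¹ j) (τ⁻¹ l), fun H j l => H _ _⟩

theorem existsUnique_inducesOrdering {m n : ℕ} (g : Fin m ↪o Fin n) (π : Equiv.Perm (Fin n)) :
    ∃! ω : Equiv.Perm (Fin m), InducesOrdering g π ω := by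
  set f : Fin m → Fin n := fun j => π (g j) with hf
  have hinj : Function.Injective f := π.injective.comp g.injective
  have hmono : StrictMono (f ∘ Tuple.sort f) :=
    (Tuple.monotone_sort f).strictMono_of_injective (hinj.comp (Tuple.sort f).injective)
  have hsort : InducesOrdering g π (Tuple.sort f)⁻¹ := fun j l => by
    have h := hmono.lt_iff_lt (a := (Tuple.sort f)⁻¹ l) (b := (Tuple.sort f)⁻¹ j)
    simpa [hf] using h.symm
  refine ⟨_, hsort, fun ω hω => ?_⟩
  have hlt : ∀ a b, ω a < ω b ↔ (Tuple.sort f)⁻¹ a < (Tuple.sort f)⁻¹ b := fun a b =>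
    (hω b a).trans (hsort b a).symm
  have hid : StrictMono (ω * Tuple.sort f) := fun a b hab => by
    simpa [hlt] using hab
  have h1 : ω * Tuple.sort f = 1 := by
    ext1 x
    exact congrArg (fun u : Fin m ≃o Fin m => u x)
      (Subsingleton.elim (hid.orderIsoOfSurjective _ (Equiv.surjective _)) (OrderIso.refl _))
  exact eq_inv_of_mul_eq_one_left h1

/-- The total outer weight of the permutations inducing the ordering `ω` on the block does not
depend on `ω`. -/
theorem sum_outerInv_eq {m n : ℕ} (g : Fin m ↪o Fin n) (hg : (Set.range g).OrdConnected)
    (q : ℝ) (ω : Equiv.Perm (Fin m)) :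
    (∑ π, {π | InducesOrdering g π ω}.indicator (fun π => q ^ (outerInv g π).card) π) =
      ∑ π, {π | InducesOrdering g π 1}.indicator (fun π => q ^ (outerInv g π).card) π := by
  classical
  symm
  refine Fintype.sum_equiv (Equiv.mulRight (ω.viaFintypeEmbedding g.toEmbedding)) _ _ fun π => ?_
  have h := inducesOrdering_mul_iff g π 1 ω
  rw [one_mul] at h
  simp only [Set.indicator_apply, Set.mem_ofPred_eq, Equiv.coe_mulRight, h,
    card_outerInv_mul g hg]

theorem sum_indicator_inducesOrdering {m n : ℕ} (g : Fin m ↪o Fin n)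
    (hg : (Set.range g).OrdConnected) (q : ℝ) (ω : Equiv.Perm (Fin m)) :
    (∑ π, {π | InducesOrdering g π ω}.indicator (fun π => q ^ mallowsInv π) π) =
      q ^ mallowsInv ω *
        ∑ π, {π | InducesOrdering g π 1}.indicator (fun π => q ^ (outerInv g π).card) π := by
  classical
  rw [← sum_outerInv_eq g hg q ω, Finset.mul_sum]
  refine Finset.sum_congr rfl fun π _ => ?_
  by_cases h : InducesOrdering g π ω
  · simp [h, h.mallowsInv_eq, pow_add]
  · simp [h]

theorem sum_pow_mallowsInv_eq_mul {m n : ℕ} (g : Fin m ↪o Fin n)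
    (hg : (Set.range g).OrdConnected) (q : ℝ) :
    (∑ π : Equiv.Perm (Fin n), q ^ mallowsInv π) =
      (∑ ω : Equiv.Perm (Fin m), q ^ mallowsInv ω) *
        ∑ π, {π | InducesOrdering g π 1}.indicator (fun π => q ^ (outerInv g π).card) π := by
  classical
  simp only [Finset.sum_mul, ← sum_indicator_inducesOrdering g hg q]
  rw [Finset.sum_comm]
  refine Finset.sum_congr rfl fun π _ => ?_
  obtain ⟨ω, hω, huniq⟩ := existsUnique_inducesOrdering g π
  rw [Finset.sum_eq_single ω]
  · simp [hω]
  · intro σ _ hσ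
    have : ¬InducesOrdering g π σ := fun h => hσ (huniq σ h)
    simp [this]
  · simp

theorem mallowsProb_inducesOrdering {m n : ℕ} (g : Fin m ↪o Fin n)
    (hg : (Set.range g).OrdConnected) {q : ℝ} (hq : 0 < q) (ω : Equiv.Perm (Fin m)) :
    mallowsProb n q {π | InducesOrdering g π ω} = mallowsPMF m q ω := by
  classical
  have hpos : (0 : ℝ) < ∑ π : Equiv.Perm (Fin n), q ^ mallowsInv π :=
    Finset.sum_pos (fun π _ => pow_pos hq _) Finset.univ_nonempty
  have hfactor := sum_pow_mallowsInv_eq_mul g hg q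
  have hprob : mallowsProb n q {π | InducesOrdering g π ω} =
      (∑ π, {π | InducesOrdering g π ω}.indicator (fun π => q ^ mallowsInv π) π) /
        ∑ π : Equiv.Perm (Fin n), q ^ mallowsInv π := by
    rw [mallowsProb, Finset.sum_div]
    refine Finset.sum_congr rfl fun π _ => ?_
    simp only [Set.indicator_apply, mallowsPMF]
    split_ifs <;> simp
  rw [hprob, sum_indicator_inducesOrdering g hg, hfactor, mallowsPMF]
  exact mul_div_mul_right _ _ fun h0 => by simp [hfactor, h0] at hpos

/-- For `π ~ μ_{n,q}` and a block `I = (i, i+1, …, i+m−1)` of `m` consecutive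
indices, the induced relative ordering `π_I` is distributed according to `μ_{m,q}`: for
every `ω ∈ S_m`, `P(π_I = ω) = μ_{m,q}({ω})`. The event `{π_I = ω}` is expressed by its
defining property `ω(j) > ω(l) ↔ π(i_j) > π(i_l)` for all `j,l`. -/
theorem mallows_induced_ordering_consecutive (n : ℕ) (hn : 1 ≤ n) (q : ℝ) (hq : 0 < q)
    (m i : ℕ) (him : i + m ≤ n) (ω : Equiv.Perm (Fin m)) :
    mallowsProb n q
      {π | ∀ j l : Fin m,
        (ω l < ω j ↔ π ⟨i + (l : ℕ), by omega⟩ < π ⟨i + (j : ℕ), by omega⟩)} =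
    mallowsPMF m q ω := by
  let g : Fin m ↪o Fin n := OrderEmbedding.ofStrictMono
    (fun j => ⟨i + (j : ℕ), by omega⟩) fun a b hab =>
      Nat.add_lt_add_left hab i
  refine mallowsProb_inducesOrdering g ⟨?_⟩ hq ω
  rintro _ ⟨a, rfl⟩ _ ⟨b, rfl⟩ x ⟨hax, hxb⟩
  have hax : i + (a : ℕ) ≤ x := hax
  have hxb : (x : ℕ) ≤ i + b := hxb
  exact ⟨⟨x - i, by omega⟩, Fin.ext (show i + ((x : ℕ) - i) = x by omega)⟩
end

section
/- There exists an absolute constant C > 0 such that the following holds. Let n≥1 be an integer, let 0 < q ≤ 1 − 2/n, let 1 ≤ m ≤ n, and let I = (i_1,…,i_m) ⊆ {1,…,n} be an increasing sequence of indices. If π is distributed according to the (n,q)-Mallows measure, then the probability that I indexes an increasing subsequence of π satisfies P(π(i_1) < π(i_2) < ⋯ < π(i_m)) ≤ (C·n·(1−q)/m)^m. -/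
open Finset

open scoped ENNReal

/-- The number of earlier entries of `f` that are smaller than the entry at `i`. -/
def earlierSmaller {n : ℕ} (f : Fin n → ℕ) (i : Fin n) : ℕ :=
  #{j | j < i ∧ f j < f i}

/-- Weight of the value `x` following the values of `f` when an unused natural number is drawn with
geometric weight in its rank among the unused numbers. -/
noncomputable def stepWeight {n : ℕ} (a : ℝ≥0∞) (f : Fin n → ℕ) (x : ℕ) : ℝ≥0∞ :=
  open Classical in
  if x ∈ Set.range f then 0 else (1 - a) * a ^ (x - #{j | f j < x})

/-- Weight of `f` as the first `n` values of the infinite Mallows process. -/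
noncomputable def mallowsProcessWeight {n : ℕ} (a : ℝ≥0∞) (f : Fin n → ℕ) : ℝ≥0∞ :=
  open Classical in
  if Function.Injective f then ∏ i, (1 - a) * a ^ (f i - earlierSmaller f i) else 0

lemma earlierSmaller_snoc_castSucc {n : ℕ} (f : Fin n → ℕ) (x : ℕ) (i : Fin n) :
    earlierSmaller (Fin.snoc f x : Fin (n + 1) → ℕ) i.castSucc = earlierSmaller f i := by
  unfold earlierSmaller
  refine (congrArg Finset.card ?_).trans (Finset.card_map Fin.castSuccEmb)
  ext j
  refine Fin.lastCases ?_ (fun j => ?_) j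
  · simp [(Fin.le_last i.castSucc).not_gt]
  · simp

lemma earlierSmaller_snoc_last {n : ℕ} (f : Fin n → ℕ) (x : ℕ) :
    earlierSmaller (Fin.snoc f x : Fin (n + 1) → ℕ) (Fin.last n) = #{j | f j < x} := by
  unfold earlierSmaller
  refine (congrArg Finset.card ?_).trans (Finset.card_map Fin.castSuccEmb)
  ext j
  refine Fin.lastCases ?_ (fun j => ?_) j
  · simp [Fin.ext_iff]; omega
  · simp [Fin.castSucc_lt_last]

lemma mallowsProcessWeight_snoc {n : ℕ} (a : ℝ≥0∞) (f : Fin n → ℕ) (x : ℕ) :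
    mallowsProcessWeight a (Fin.snoc f x : Fin (n + 1) → ℕ) =
      mallowsProcessWeight a f * stepWeight a f x := by
  classical
  unfold mallowsProcessWeight stepWeight
  simp only [Fin.snoc_injective_iff, Fin.prod_univ_castSucc,
    earlierSmaller_snoc_castSucc, earlierSmaller_snoc_last, Fin.snoc_castSucc, Fin.snoc_last]
  by_cases h : Function.Injective f <;> by_cases h' : x ∈ Set.range f <;> simp [h, h']

lemma tsum_one_sub_mul_pow {a : ℝ≥0∞} (ha : a < 1) : ∑' k : ℕ, (1 - a) * a ^ k = 1 := by
  rw [ENNReal.tsum_mul_left, ENNReal.tsum_geometric]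
  exact ENNReal.mul_inv_cancel (tsub_pos_of_lt ha).ne' (by finiteness)

lemma tsum_notMem_sub_card (S : Finset ℕ) (h : ℕ → ℝ≥0∞) :
    ∑' x, (if x ∈ S then 0 else h (x - #{y ∈ S | y < x})) = ∑' k, h k := by
  have hinf : {x | x ∉ S}.Infinite := S.finite_toSet.infinite_compl
  have hc : ∀ x, x - #{y ∈ S | y < x} = Nat.count (fun x => x ∉ S) x := by
    intro x
    rw [Nat.count_eq_card_filter_range]
    have h1 := Finset.card_filter_add_card_filter_not (s := range x) (fun y => y ∈ S)
    have h2 : {y ∈ S | y < x} = {y ∈ range x | y ∈ S} := by ext; simp [and_comm]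
    rw [h2]
    rw [Finset.card_range] at h1
    omega
  rw [← (Nat.nth_injective hinf).tsum_eq]
  · refine tsum_congr fun k => ?_
    have := Nat.nth_mem_of_infinite hinf k
    rw [if_neg this, hc, Nat.count_nth_of_infinite hinf]
  · intro x hx
    rw [Nat.range_nth_of_infinite hinf]
    intro hS
    simp [hS] at hx

lemma tsum_stepWeight {n : ℕ} {a : ℝ≥0∞} (ha : a < 1) {f : Fin n → ℕ}
    (hf : Function.Injective f) : ∑' x, stepWeight a f x = 1 := by
  classical
  rw [← tsum_one_sub_mul_pow ha, ← tsum_notMem_sub_card (univ.map ⟨f, hf⟩) fun k => (1 - a) * a ^ k]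
  refine tsum_congr fun x => ?_
  unfold stepWeight
  have h : #{y ∈ univ.map ⟨f, hf⟩ | y < x} = #{j | f j < x} := by
    rw [Finset.filter_map, Finset.card_map]
    rfl
  rw [h]
  simp

lemma tsum_mallowsProcessWeight_mul_stepWeight {n : ℕ} {a : ℝ≥0∞} (ha : a < 1)
    (f : Fin n → ℕ) :
    ∑' x, mallowsProcessWeight a f * stepWeight a f x = mallowsProcessWeight a f := by
  rw [ENNReal.tsum_mul_left]
  by_cases hf : Function.Injective f
  · rw [tsum_stepWeight ha hf, mul_one]
  · simp [mallowsProcessWeight, hf]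

lemma tsum_snoc {n : ℕ} (F : (Fin (n + 1) → ℕ) → ℝ≥0∞) :
    ∑' f, F f = ∑' (f : Fin n → ℕ) (x : ℕ), F (Fin.snoc f x : Fin (n + 1) → ℕ) := by
  rw [← (Fin.snocEquiv (fun _ : Fin (n + 1) => ℕ)).tsum_eq, ENNReal.tsum_prod',
    ENNReal.tsum_comm]
  rfl

lemma tsum_mallowsProcessWeight {a : ℝ≥0∞} (ha : a < 1) (n : ℕ) :
    ∑' f : Fin n → ℕ, mallowsProcessWeight a f = 1 := by
  induction n with
  | zero => simp [mallowsProcessWeight, Function.injective_of_subsingleton]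
  | succ n ih =>
    simp_rw [tsum_snoc, mallowsProcessWeight_snoc, tsum_mallowsProcessWeight_mul_stepWeight ha, ih]

lemma stepWeight_le {n N : ℕ} (hn : n ≤ N) {a : ℝ≥0∞} (ha : a < 1) (f : Fin n → ℕ) (x : ℕ) :
    stepWeight a f x ≤ (1 - a) * a ^ (x - N) := by
  unfold stepWeight
  split_ifs
  · exact zero_le
  · have h : #{j | f j < x} ≤ n := (card_filter_le _ _).trans (by simp)
    exact mul_le_mul' le_rfl (pow_le_pow_right_of_le_one' ha.le (by omega))

/-- The values of the infinite Mallows process at selected times are dominated by independent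
variables with weights `(1 - a) * a ^ (x - N)`. -/
lemma tsum_mallowsProcessWeight_mul_le {a : ℝ≥0∞} (ha : a < 1) {N : ℕ} (n : ℕ) :
    n ≤ N → ∀ (m : ℕ) (I : Fin m → Fin n), StrictMono I → ∀ Φ : (Fin m → ℕ) → ℝ≥0∞,
      ∑' f, mallowsProcessWeight a f * Φ (f ∘ I) ≤
        ∑' v : Fin m → ℕ, (∏ j, (1 - a) * a ^ (v j - N)) * Φ v := by
  induction n with
  | zero =>
    intro _ m I _ Φ
    obtain rfl : m = 0 := by
      by_contra h
      exact (I ⟨0, Nat.pos_of_ne_zero h⟩).elim0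
    have h : ∀ F : (Fin 0 → ℕ) → ℝ≥0∞, ∑' f, F f = F Fin.elim0 := fun F =>
      tsum_eq_single _ fun f hf => (hf (Subsingleton.elim _ _)).elim
    rw [h, h, Subsingleton.elim (Fin.elim0 ∘ I) (Fin.elim0 : Fin 0 → ℕ)]
    simp [mallowsProcessWeight, Function.injective_of_subsingleton]
  | succ n ih =>
    intro hn m I hI Φ
    rw [tsum_snoc]
    simp_rw [mallowsProcessWeight_snoc]
    by_cases hlast : Fin.last n ∈ Set.range I
    · obtain ⟨j, hj⟩ := hlast
      obtain ⟨k, rfl⟩ : ∃ k, m = k + 1 := ⟨m - 1, by have := j.2; omega⟩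
      have hIlast : I (Fin.last k) = Fin.last n :=
        le_antisymm (Fin.le_last _) (hj ▸ hI.monotone (Fin.le_last j))
      have hlt : ∀ i : Fin k, I i.castSucc ≠ Fin.last n := fun i h =>
        (hI (Fin.castSucc_lt_last i)).ne (h.trans hIlast.symm)
      let I' : Fin k → Fin n := fun i => (I i.castSucc).castPred (hlt i)
      have hI' : StrictMono I' := fun i j hij => by
        simpa [I'] using hI (Fin.castSucc_lt_castSucc_iff.2 hij)
      have hcomp : ∀ (f : Fin n → ℕ) (x : ℕ),
          (Fin.snoc f x : Fin (n + 1) → ℕ) ∘ I = (Fin.snoc (f ∘ I') x : Fin (k + 1) → ℕ) := by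
        intro f x
        ext i
        refine Fin.lastCases ?_ (fun i => ?_) i
        · simp [hIlast]
        · have : I i.castSucc = (I' i).castSucc := by simp [I']
          simp [this]
      calc ∑' (f : Fin n → ℕ) (x : ℕ), mallowsProcessWeight a f * stepWeight a f x *
            Φ ((Fin.snoc f x : Fin (n + 1) → ℕ) ∘ I)
          ≤ ∑' (f : Fin n → ℕ) (x : ℕ), mallowsProcessWeight a f * ((1 - a) * a ^ (x - N)) *
            Φ (Fin.snoc (f ∘ I') x : Fin (k + 1) → ℕ) := by
            gcongr with f x
            · exact stepWeight_le (by omega) ha f x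
            · rw [hcomp]
        _ = ∑' (x : ℕ), ∑' (f : Fin n → ℕ), mallowsProcessWeight a f * (((1 - a) * a ^ (x - N)) *
            Φ (Fin.snoc (f ∘ I') x : Fin (k + 1) → ℕ)) := by
            rw [ENNReal.tsum_comm]
            simp_rw [mul_assoc]
        _ ≤ ∑' (x : ℕ), ∑' v : Fin k → ℕ, (∏ j, (1 - a) * a ^ (v j - N)) *
            (((1 - a) * a ^ (x - N)) * Φ (Fin.snoc v x : Fin (k + 1) → ℕ)) := by
            gcongr with x
            exact ih (by omega) k I' hI' fun v =>
              ((1 - a) * a ^ (x - N)) * Φ (Fin.snoc v x : Fin (k + 1) → ℕ)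
        _ = _ := by
            rw [ENNReal.tsum_comm, tsum_snoc]
            simp_rw [Fin.prod_univ_castSucc, Fin.snoc_castSucc, Fin.snoc_last, mul_assoc]
    · have hlt : ∀ i, I i ≠ Fin.last n := fun i h => hlast ⟨i, h⟩
      let I' : Fin m → Fin n := fun i => (I i).castPred (hlt i)
      have hI' : StrictMono I' := fun i j hij => by simpa [I'] using hI hij
      have hcomp : ∀ (f : Fin n → ℕ) (x : ℕ),
          (Fin.snoc f x : Fin (n + 1) → ℕ) ∘ I = f ∘ I' := by
        intro f x
        ext i
        have : I i = (I' i).castSucc := by simp [I']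
        simp [this]
      simp_rw [hcomp, ENNReal.tsum_mul_right, tsum_mallowsProcessWeight_mul_stepWeight ha]
      exact ih (by omega) m I' hI' Φ

lemma tsum_prod_pow (u : ℕ → ℝ≥0∞) (m : ℕ) :
    ∑' v : Fin m → ℕ, ∏ j, u (v j) = (∑' x, u x) ^ m := by
  induction m with
  | zero => simp
  | succ m ih =>
    simp_rw [tsum_snoc, Fin.prod_univ_castSucc, Fin.snoc_castSucc, Fin.snoc_last,
      ENNReal.tsum_mul_left, ENNReal.tsum_mul_right, ih, pow_succ]

lemma factorial_mul_tsum_strictMono_le (u : ℕ → ℝ≥0∞) (m : ℕ) :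
    (m.factorial : ℝ≥0∞) *
        ∑' v : Fin m → ℕ, (∏ j, u (v j)) * Set.indicator {v | StrictMono v} 1 v ≤
      (∑' x, u x) ^ m := by
  classical
  have hsym : ∀ σ : Equiv.Perm (Fin m),
      ∑' v : Fin m → ℕ, (∏ j, u (v j)) * Set.indicator {v | StrictMono v} 1 v =
      ∑' v : Fin m → ℕ, (∏ j, u (v j)) * Set.indicator {v | StrictMono v} 1 (v ∘ σ) := by
    intro σ
    rw [← (Equiv.arrowCongr σ.symm (Equiv.refl ℕ)).tsum_eq]
    refine tsum_congr fun v => ?_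
    congr 1
    exact Equiv.prod_comp σ fun j => u (v j)
  calc (m.factorial : ℝ≥0∞) *
        ∑' v : Fin m → ℕ, (∏ j, u (v j)) * Set.indicator {v | StrictMono v} 1 v
      = ∑ σ : Equiv.Perm (Fin m), ∑' v : Fin m → ℕ, (∏ j, u (v j)) *
          Set.indicator {v | StrictMono v} 1 (v ∘ σ) := by
        rw [← Finset.sum_congr rfl fun σ _ => hsym σ]
        simp [Fintype.card_perm]
    _ = ∑' v : Fin m → ℕ, (∏ j, u (v j)) * ∑ σ : Equiv.Perm (Fin m),
          Set.indicator {v | StrictMono v} 1 (v ∘ σ) := by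
        rw [← Summable.tsum_finsetSum fun _ _ => ENNReal.summable]
        simp_rw [Finset.mul_sum]
    _ ≤ ∑' v : Fin m → ℕ, (∏ j, u (v j)) * 1 := by
        gcongr with v
        simp only [Set.indicator_apply, Set.mem_ofPred_eq, Pi.one_apply, Finset.sum_boole]
        norm_cast
        rw [Finset.card_le_one]
        intro σ hσ τ hτ
        simp only [mem_filter, mem_univ, true_and] at hσ hτ
        have hv : Function.Injective v := fun i j hij => by
          have := hσ.injective (a₁ := σ.symm i) (a₂ := σ.symm j) (by simpa using hij)
          simpa using this
        have : v ∘ σ = v ∘ τ := (hσ.range_inj hτ).1 (by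
          rw [σ.surjective.range_comp, τ.surjective.range_comp])
        ext i
        exact congrArg Fin.val (hv (congrFun this i))
    _ = _ := by simp_rw [mul_one, tsum_prod_pow]

lemma tsum_one_sub_mul_pow_sub {a : ℝ≥0∞} (ha : a < 1) (N : ℕ) :
    ∑' x : ℕ, (1 - a) * a ^ (x - N) = N * (1 - a) + 1 := by
  rw [← Summable.sum_add_tsum_nat_add' (k := N) ENNReal.summable]
  simp_rw [Nat.add_sub_cancel, tsum_one_sub_mul_pow ha]
  congr 1
  rw [Finset.sum_congr rfl fun x hx => by
    rw [Nat.sub_eq_zero_of_le (Finset.mem_range.1 hx).le, pow_zero, mul_one]]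
  simp

/-- Every injective sequence is uniquely a strictly increasing sequence rearranged. -/
lemma bijective_rearrange (n : ℕ) : Function.Bijective
    (fun p : Equiv.Perm (Fin n) × {e : Fin n → ℕ // StrictMono e} =>
      (⟨p.2.1 ∘ p.1, p.2.2.injective.comp p.1.injective⟩ :
        {f : Fin n → ℕ // Function.Injective f})) := by
  constructor
  · rintro ⟨σ, e, he⟩ ⟨τ, e', he'⟩ h
    simp only [Subtype.mk.injEq] at h
    have hee : e = e' := (he.range_inj he').1 (by
      rw [← σ.surjective.range_comp e, h, τ.surjective.range_comp])
    subst hee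
    simp only [Prod.mk.injEq, and_true]
    ext i
    exact congrArg Fin.val (he.injective (congrFun h i))
  · rintro ⟨f, hf⟩
    refine ⟨((Tuple.sort f).symm, ⟨f ∘ Tuple.sort f,
      (Tuple.monotone_sort f).strictMono_of_injective (hf.comp (Tuple.sort f).injective)⟩), ?_⟩
    ext i
    simp

lemma earlierSmaller_le {n : ℕ} {f : Fin n → ℕ} (hf : Function.Injective f) (i : Fin n) :
    earlierSmaller f i ≤ f i := by
  unfold earlierSmaller
  rw [← Finset.card_map ⟨f, hf⟩]
  conv_rhs => rw [← Finset.card_range (f i)]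
  refine Finset.card_le_card fun x hx => ?_
  simp only [mem_map, mem_filter, mem_univ, true_and, Function.Embedding.coeFn_mk] at hx
  obtain ⟨j, hj, rfl⟩ := hx
  exact Finset.mem_range.2 hj.2

lemma sum_earlierSmaller {n : ℕ} {e : Fin n → ℕ} (he : StrictMono e) (π : Equiv.Perm (Fin n)) :
    ∑ i, earlierSmaller (e ∘ π) i + mallowsInv π = ∑ i, earlierSmaller e i := by
  have h : ∀ f : Fin n → ℕ, ∑ i, earlierSmaller f i =
      #{p : Fin n × Fin n | p.1 < p.2 ∧ f p.1 < f p.2} := by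
    intro f
    simp_rw [earlierSmaller, Finset.card_filter, Fintype.sum_prod_type_right]
  rw [h, h, mallowsInv, ← Finset.card_union_of_disjoint]
  · congr 1
    ext ⟨i, j⟩
    simp only [mem_union, mem_filter, mem_univ, true_and, Function.comp_apply, he.lt_iff_lt]
    have : i < j → π i ≠ π j := fun hij h => hij.ne (π.injective h)
    grind
  · rw [Finset.disjoint_filter]
    rintro ⟨i, j⟩ _ h1 h2
    exact lt_asymm (he.lt_iff_lt.1 h1.2) h2.2

lemma mallowsProcessWeight_comp_perm {n : ℕ} (a : ℝ≥0∞) {e : Fin n → ℕ} (he : StrictMono e)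
    (π : Equiv.Perm (Fin n)) :
    mallowsProcessWeight a (e ∘ π) = a ^ mallowsInv π * mallowsProcessWeight a e := by
  have hπ := he.injective.comp π.injective
  have hsum : ∀ f : Fin n → ℕ, Function.Injective f →
      ∑ i, (f i - earlierSmaller f i) + ∑ i, earlierSmaller f i = ∑ i, f i := by
    intro f hf
    rw [← Finset.sum_add_distrib]
    exact Finset.sum_congr rfl fun i _ => Nat.sub_add_cancel (earlierSmaller_le hf i)
  have h1 := hsum _ hπ
  have h2 := hsum _ he.injective
  have h3 := sum_earlierSmaller he π
  have h4 : ∑ i, (e ∘ π) i = ∑ i, e i := Equiv.sum_comp π e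
  rw [mallowsProcessWeight, mallowsProcessWeight, if_pos hπ, if_pos he.injective,
    Finset.prod_mul_distrib, Finset.prod_mul_distrib, Finset.prod_pow_eq_pow_sum,
    Finset.prod_pow_eq_pow_sum, mul_left_comm, ← pow_add]
  congr 2
  omega

lemma tsum_mallowsProcessWeight_mul {n : ℕ} (a : ℝ≥0∞) (Φ : (Fin n → ℕ) → ℝ≥0∞)
    (φ : Equiv.Perm (Fin n) → ℝ≥0∞) (hΦ : ∀ e, StrictMono e → ∀ π : Equiv.Perm (Fin n),
      Φ (e ∘ π) = φ π) :
    ∑' f, mallowsProcessWeight a f * Φ f =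
      (∑ π : Equiv.Perm (Fin n), a ^ mallowsInv π * φ π) *
        ∑' e : {e : Fin n → ℕ // StrictMono e}, mallowsProcessWeight a e.1 := by
  rw [← tsum_subtype_eq_of_support_subset (s := {f | Function.Injective f})]
  · change ∑' f : {f : Fin n → ℕ // Function.Injective f}, mallowsProcessWeight a f.1 * Φ f.1 = _
    rw [← (Equiv.ofBijective _ (bijective_rearrange n)).tsum_eq, ENNReal.tsum_prod', tsum_fintype,
      Finset.sum_mul]
    refine Finset.sum_congr rfl fun π _ => ?_
    rw [← ENNReal.tsum_mul_left]
    refine tsum_congr fun e => ?_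
    simp only [Equiv.ofBijective_apply, mallowsProcessWeight_comp_perm a e.2, hΦ _ e.2]
    ring
  · intro f hf
    by_contra h
    simp [mallowsProcessWeight, show ¬ Function.Injective f from h] at hf

lemma factorial_mul_sum_strictMono_le {n m : ℕ} {a : ℝ≥0∞} (ha : a < 1) {I : Fin m → Fin n}
    (hI : StrictMono I) :
    (m.factorial : ℝ≥0∞) * ∑ π : Equiv.Perm (Fin n), a ^ mallowsInv π *
        Set.indicator {π : Equiv.Perm (Fin n) | StrictMono fun j => π (I j)} 1 π ≤
      (n * (1 - a) + 1) ^ m * ∑ π : Equiv.Perm (Fin n), a ^ mallowsInv π := by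
  have htot := tsum_mallowsProcessWeight_mul (n := n) a (fun _ => 1) (fun _ => 1)
    fun _ _ _ => rfl
  have hinc := tsum_mallowsProcessWeight_mul (n := n) a
    (fun f => Set.indicator {v : Fin m → ℕ | StrictMono v} 1 (f ∘ I))
    (Set.indicator {π : Equiv.Perm (Fin n) | StrictMono fun j => π (I j)} 1) (by
      intro e he π
      have : StrictMono ((e ∘ π) ∘ I) ↔ StrictMono fun j => π (I j) :=
        forall₃_congr fun i j _ => he.lt_iff_lt
      simp only [Set.indicator_apply, Set.mem_ofPred_eq, this, Pi.one_apply])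
  simp only [mul_one] at htot
  rw [tsum_mallowsProcessWeight ha] at htot
  have hle := (mul_le_mul_right (tsum_mallowsProcessWeight_mul_le ha n le_rfl m I hI
    (Set.indicator {v | StrictMono v} 1)) (m.factorial : ℝ≥0∞)).trans
      (factorial_mul_tsum_strictMono_le (fun x => (1 - a) * a ^ (x - n)) m)
  rw [tsum_one_sub_mul_pow_sub ha, hinc] at hle
  set Z := ∑ π : Equiv.Perm (Fin n), a ^ mallowsInv π
  set K := ∑' e : {e : Fin n → ℕ // StrictMono e}, mallowsProcessWeight a e.1
  calc _ = _ * (Z * K) := by rw [← htot, mul_one]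
    _ = (m.factorial * (_ * K)) * Z := by ring
    _ ≤ _ := mul_le_mul_left hle Z

lemma factorial_mul_mallowsProb_strictMono_le {n m : ℕ} {q : ℝ} (hq : 0 < q) (hq1 : q < 1)
    {I : Fin m → Fin n} (hI : StrictMono I) :
    m.factorial * mallowsProb n q {π | StrictMono fun j => π (I j)} ≤
      (n * (1 - q) + 1) ^ m := by
  classical
  have h := factorial_mul_sum_strictMono_le (ENNReal.ofReal_lt_one.2 hq1) hI
  have hnn : 0 ≤ (n : ℝ) * (1 - q) + 1 := by
    have : 0 ≤ 1 - q := by linarith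
    positivity
  have hZ : 0 < ∑ σ : Equiv.Perm (Fin n), q ^ mallowsInv σ :=
    Finset.sum_pos (fun σ _ => pow_pos hq _) Finset.univ_nonempty
  have h1 : ∀ π : Equiv.Perm (Fin n), ENNReal.ofReal q ^ mallowsInv π *
      Set.indicator {π : Equiv.Perm (Fin n) | StrictMono fun j => π (I j)} 1 π =
      ENNReal.ofReal (Set.indicator {π : Equiv.Perm (Fin n) | StrictMono fun j => π (I j)}
        (fun π => q ^ mallowsInv π) π) := by
    intro π
    by_cases hπ : StrictMono fun j => π (I j) <;>
      simp [hπ, ENNReal.ofReal_pow hq.le]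
  have h2 : (n : ℝ≥0∞) * (1 - ENNReal.ofReal q) + 1 = ENNReal.ofReal (n * (1 - q) + 1) := by
    have : 0 ≤ 1 - q := by linarith
    rw [ENNReal.ofReal_add (by positivity) zero_le_one, ENNReal.ofReal_mul (by positivity),
      ENNReal.ofReal_sub _ hq.le]
    simp
  simp_rw [h1, h2, ← ENNReal.ofReal_pow hq.le] at h
  rw [← ENNReal.ofReal_sum_of_nonneg fun π _ => Set.indicator_nonneg
      (fun _ _ => pow_nonneg hq.le _) π,
    ← ENNReal.ofReal_sum_of_nonneg fun π _ => pow_nonneg hq.le _,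
    ← ENNReal.ofReal_natCast, ← ENNReal.ofReal_mul (by positivity), ← ENNReal.ofReal_pow hnn,
    ← ENNReal.ofReal_mul (by positivity), ENNReal.ofReal_le_ofReal_iff (by positivity)] at h
  have h3 : mallowsProb n q {π | StrictMono fun j => π (I j)} =
      (∑ π, Set.indicator {π : Equiv.Perm (Fin n) | StrictMono fun j => π (I j)}
        (fun π => q ^ mallowsInv π) π) / ∑ σ : Equiv.Perm (Fin n), q ^ mallowsInv σ := by
    rw [mallowsProb, Finset.sum_div]
    refine Finset.sum_congr rfl fun π _ => ?_
    by_cases hπ : StrictMono fun j => π (I j) <;> simp [hπ, mallowsPMF]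
  rw [h3, ← mul_div_assoc, div_le_iff₀ hZ]
  exact h

/-- There is an absolute constant `C>0` so that for `n≥1`, `0<q≤1−2/n`,
`1≤m≤n` and any increasing sequence of indices `I = (i_1,…,i_m)` in `{1,…,n}`, if
`π ~ μ_{n,q}` then `P(π(i_1) < ⋯ < π(i_m)) ≤ (C·n·(1−q)/m)^m`. -/
theorem mallows_increasing_on_fixed_indices :
    ∃ C : ℝ, 0 < C ∧
      ∀ (n : ℕ) (q : ℝ) (m : ℕ) (I : Fin m → Fin n),
        1 ≤ n → 0 < q → q ≤ 1 - 2 / (n : ℝ) → 1 ≤ m → m ≤ n → StrictMono I →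
        mallowsProb n q {π | StrictMono (fun j => π (I j))} ≤
          (C * (n : ℝ) * (1 - q) / (m : ℝ)) ^ m := by
  refine ⟨2 * Real.exp 1, by positivity, fun n q m I hn hq hqn hm _ hI => ?_⟩
  have hn0 : (0 : ℝ) < n := by exact_mod_cast hn
  have hm0 : (0 : ℝ) < m := by exact_mod_cast hm
  have hnq : 2 ≤ n * (1 - q) := by
    have : 2 / (n : ℝ) ≤ 1 - q := by linarith
    rw [div_le_iff₀ hn0] at this
    linarith
  have hq1 : q < 1 := by
    have : 0 < 2 / (n : ℝ) := by positivity
    linarith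
  have hfac : (0 : ℝ) < m.factorial := by exact_mod_cast m.factorial_pos
  have hexp : (m : ℝ) ^ m ≤ Real.exp 1 ^ m * m.factorial := by
    have := Real.pow_div_factorial_le_exp (m : ℝ) hm0.le m
    rwa [div_le_iff₀ hfac, ← Real.exp_one_pow m] at this
  have hp := factorial_mul_mallowsProb_strictMono_le hq hq1 hI
  have hbound : (n * (1 - q) + 1) ^ m ≤ (2 * (n * (1 - q))) ^ m := by
    gcongr
    linarith
  rw [div_pow, le_div_iff₀ (by positivity), ← mul_le_mul_iff_of_pos_left hfac, ← mul_assoc]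
  calc _ ≤ (2 * (n * (1 - q))) ^ m * (Real.exp 1 ^ m * m.factorial) := by
        gcongr
        exact hp.trans hbound
    _ = _ := by
        simp only [mul_pow]
        ring
end
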